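/- arXiv:0710.5338 — 2 statements merged into one kernel-verified Lean document; each statement's English description precedes it below -/
import Mathlib

section
/- Fix constants δ ∈ (0,1) and c > 1 and weights w1 ≥ 2·w2 > 0. Suppose m = m(n) satisfies m - n ≥ m/c for all n and m/n^{4/3} → 0 as n → ∞. Then the probability that a random instance of the complete and strict 2-weighted popular matching problem with n applicants (|A1| = δn, |A2| = (1-δ)n) and m items has a 2-weighted popular matching tends to 0 as n → ∞ (along those n for which δn is an integer). -/
open scoped Classical
open Finset

noncomputable section

/-- An instance of the complete and strict 2-weighted popular matching problem:
applicants `A` partitioned into categories `A1` (weight `w1`) and `A2` (weight `w2`),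
items `I` with `|A| < |I|`, and for each applicant a strict complete preference list
encoded by an injective ranking function (smaller rank = more preferred). -/
structure TwoWPM (A I : Type) [Fintype A] [DecidableEq A] [Fintype I] [DecidableEq I] where
  A1 : Finset A
  A2 : Finset A
  union_eq : A1 ∪ A2 = Finset.univ
  disj : Disjoint A1 A2
  w1 : ℝ
  w2 : ℝ
  hw12 : w2 < w1
  hw2 : 0 < w2
  rank : A → I → ℕ
  rank_inj : ∀ x : A, Function.Injective (rank x)
  card_lt : Fintype.card A < Fintype.card I

namespace TwoWPM

variable {A I : Type} [Fintype A] [DecidableEq A] [Fintype I] [DecidableEq I]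
variable (P : TwoWPM A I)

/-- applicant `x` prefers item `p` to item `q`. -/
def Prefers (x : A) (p q : I) : Prop := P.rank x p < P.rank x q

/-- the most preferred item of applicant `x` within the set `s` (junk value if `s = ∅`). -/
def bestIn (x : A) (s : Finset I) : I :=
  if hs : s.Nonempty then (Finset.exists_min_image s (P.rank x) hs).choose
  else (Fintype.card_pos_iff.mp (Nat.lt_of_le_of_lt (Nat.zero_le _) P.card_lt)).some

/-- the first item of an applicant of the first category. -/
def f1 (x : A) : I := P.bestIn x Finset.univ
/-- the set of `f1`-items. -/
def F1 : Finset I := P.A1.image P.f1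
/-- the second item of an applicant of the first category. -/
def s1 (x : A) : I := P.bestIn x (Finset.univ \ P.F1)
/-- the set of `s1`-items. -/
def S1 : Finset I := P.A1.image P.s1
/-- the first item of an applicant of the second category. -/
def f2 (y : A) : I := P.bestIn y (Finset.univ \ P.F1)
/-- the set of `f2`-items. -/
def F2 : Finset I := P.A2.image P.f2
/-- the second item of an applicant of the second category. -/
def s2 (y : A) : I := P.bestIn y (Finset.univ \ (P.F1 ∪ P.F2))
/-- the set of `s2`-items. -/
def S2 : Finset I := P.A2.image P.s2

/-- the weight of an applicant. -/
def weight (x : A) : ℝ := if x ∈ P.A1 then P.w1 else P.w2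

/-- `M` is more popular than `M'`: the total weight of applicants preferring `M`
exceeds the total weight of applicants preferring `M'`. -/
def MorePopular (M M' : A → I) : Prop :=
  (∑ x : A, if P.Prefers x (M' x) (M x) then P.weight x else 0) <
    ∑ x : A, if P.Prefers x (M x) (M' x) then P.weight x else 0

/-- `M` is a 2-weighted popular matching. -/
def IsPopular (M : A → I) : Prop :=
  Function.Injective M ∧ ∀ M' : A → I, Function.Injective M' → ¬ P.MorePopular M' M

/-- `M` is a well-formed matching. -/
def IsWellFormed (M : A → I) : Prop :=
  Function.Injective M ∧
  (∀ x ∈ P.A1, M x = P.f1 x ∨ M x = P.s1 x) ∧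
  (∀ y ∈ P.A2, M y = P.f2 y ∨ M y = P.s2 y) ∧
  (∀ p ∈ P.F1, ∃ x ∈ P.A1, P.f1 x = p ∧ M x = p) ∧
  (∀ q ∈ P.F2, ∃ y ∈ P.A2, P.f2 y = q ∧ M y = q)

/-- the instance has a 2-weighted popular matching. -/
def HasPopular : Prop := ∃ M : A → I, P.IsPopular M

/-- the instance has a well-formed matching. -/
def HasWellFormed : Prop := ∃ M : A → I, P.IsWellFormed M

/-- the `f`-endpoint of the fs-relation-graph edge associated with applicant `a`. -/
def fEnd (a : A) : I := if a ∈ P.A1 then P.f1 a else P.f2 a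
/-- the `s`-endpoint of the fs-relation-graph edge associated with applicant `a`. -/
def sEnd (a : A) : I := if a ∈ P.A1 then P.s1 a else P.s2 a

/-- the edge of applicant `a` joins items `p` and `q` in the fs-relation graph. -/
def EdgeJoins (a : A) (p q : I) : Prop :=
  (P.fEnd a = p ∧ P.sEnd a = q) ∨ (P.fEnd a = q ∧ P.sEnd a = p)

/-- adjacency in the fs-relation graph. -/
def Adj (p q : I) : Prop := ∃ a : A, P.EdgeJoins a p q

/-- a simple path in the fs-relation graph with `k` (distinct) vertices
`v 0, …, v (k-1)` and edges `e 0, …, e (k-2)`, edge `e i` joining `v i` and `v (i+1)`. -/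
def IsPath (k : ℕ) (v : ℕ → I) (e : ℕ → A) : Prop :=
  (∀ i j, i < k → j < k → v i = v j → i = j) ∧
  (∀ i, i + 1 < k → P.EdgeJoins (e i) (v i) (v (i + 1)))

/-- a simple cycle in the fs-relation graph with `ℓ ≥ 2` distinct vertices and
`ℓ` distinct edges. -/
def IsCycle (ℓ : ℕ) (u : ℕ → I) (c : ℕ → A) : Prop :=
  2 ≤ ℓ ∧
  (∀ i j, i < ℓ → j < ℓ → u i = u j → i = j) ∧
  (∀ i j, i < ℓ → j < ℓ → c i = c j → i = j) ∧
  (∀ i, i < ℓ → P.EdgeJoins (c i) (u i) (u ((i + 1) % ℓ)))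

/-- a bad subgraph of type `G1`: a simple path on `k ≥ 4` vertices whose first and
last edges belong to `E2`, whose second and second-to-last edges belong to `E1`,
and whose second and second-to-last vertices lie in `S1 ∩ F2`. -/
def HasBadG1 : Prop :=
  ∃ (k : ℕ) (v : ℕ → I) (e : ℕ → A),
    4 ≤ k ∧ P.IsPath k v e ∧
    e 0 ∈ P.A2 ∧ e 1 ∈ P.A1 ∧ e (k - 2) ∈ P.A2 ∧ e (k - 3) ∈ P.A1 ∧
    v 1 ∈ P.S1 ∧ v 1 ∈ P.F2 ∧ v (k - 2) ∈ P.S1 ∧ v (k - 2) ∈ P.F2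

/-- a bad subgraph of type `G2`: a simple cycle together with a simple path on
`k ≥ 3` vertices meeting the cycle exactly in its last vertex, whose first edge is
in `E2`, second edge in `E1`, and second vertex in `S1 ∩ F2`. -/
def HasBadG2 : Prop :=
  ∃ (ℓ : ℕ) (u : ℕ → I) (c : ℕ → A) (k : ℕ) (v : ℕ → I) (e : ℕ → A),
    P.IsCycle ℓ u c ∧ 3 ≤ k ∧ P.IsPath k v e ∧
    (∃ j, j < ℓ ∧ u j = v (k - 1)) ∧
    (∀ i, i < k - 1 → ∀ j, j < ℓ → v i ≠ u j) ∧
    e 0 ∈ P.A2 ∧ e 1 ∈ P.A1 ∧ v 1 ∈ P.S1 ∧ v 1 ∈ P.F2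

/-- a bad subgraph of type `G3`: two distinct cycles lying in the same connected
component of the fs-relation graph. -/
def HasBadG3 : Prop :=
  ∃ (ℓ : ℕ) (u : ℕ → I) (c : ℕ → A) (ℓ' : ℕ) (u' : ℕ → I) (c' : ℕ → A),
    P.IsCycle ℓ u c ∧ P.IsCycle ℓ' u' c' ∧
    {a : A | ∃ i, i < ℓ ∧ c i = a} ≠ {a : A | ∃ i, i < ℓ' ∧ c' i = a} ∧
    Relation.ReflTransGen P.Adj (u 0) (u' 0)

end TwoWPM
/-- The instance of the complete and strict 2-weighted popular matching problem on
applicants `Fin n` (the first `k` of which form the first category) and items `Fin m`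
determined by a profile `σ` of preference lists (rankings) of the applicants. -/
def instOf (n k m : ℕ) (w1 w2 : ℝ) (h : n < m ∧ w2 < w1 ∧ 0 < w2)
    (σ : Fin n → (Fin m ≃ Fin m)) : TwoWPM (Fin n) (Fin m) where
  A1 := Finset.univ.filter fun x : Fin n => (x : ℕ) < k
  A2 := Finset.univ.filter fun x : Fin n => ¬ (x : ℕ) < k
  union_eq := by
    ext x
    simp only [Finset.mem_union, Finset.mem_filter, Finset.mem_univ, true_and, iff_true]
    tauto
  disj := by
    simp only [Finset.disjoint_left, Finset.mem_filter]
    tauto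
  w1 := w1
  w2 := w2
  hw12 := h.2.1
  hw2 := h.2.2
  rank := fun x i => (σ x i : ℕ)
  rank_inj := fun x a b hab => (σ x).injective (Fin.val_injective hab)
  card_lt := by simpa using h.1

/-- the probability that a uniformly random instance of the complete and strict
2-weighted popular matching problem with `n` applicants (the first `k` forming the
first category), `m` items and weights `w1`, `w2` has a 2-weighted popular matching:
each applicant's preference list is an independent uniformly random linear order,
i.e. a uniformly random ranking bijection. -/
def pmProb (n k m : ℕ) (w1 w2 : ℝ) : ℝ :=
  if h : n < m ∧ w2 < w1 ∧ 0 < w2 then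
    ((Finset.univ.filter fun σ : Fin n → (Fin m ≃ Fin m) =>
        (instOf n k m w1 w2 h σ).HasPopular).card : ℝ) /
      (Fintype.card (Fin n → (Fin m ≃ Fin m)) : ℝ)
  else 0

namespace TwoWPM

variable {A I : Type} [Fintype A] [DecidableEq A] [Fintype I] [DecidableEq I]
variable (P : TwoWPM A I)

theorem bestIn_mem (x : A) {s : Finset I} (hs : s.Nonempty) : P.bestIn x s ∈ s := by
  unfold bestIn
  rw [dif_pos hs]
  exact (Finset.exists_min_image s (P.rank x) hs).choose_spec.1

theorem rank_bestIn_le (x : A) {s : Finset I} {q : I} (hq : q ∈ s) :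
    P.rank x (P.bestIn x s) ≤ P.rank x q := by
  have hs : s.Nonempty := ⟨q, hq⟩
  unfold bestIn
  rw [dif_pos hs]
  exact (Finset.exists_min_image s (P.rank x) hs).choose_spec.2 q hq

theorem prefers_bestIn (x : A) {s : Finset I} {q : I} (hq : q ∈ s) (hne : q ≠ P.bestIn x s) :
    P.Prefers x (P.bestIn x s) q :=
  lt_of_le_of_ne (P.rank_bestIn_le x hq) fun h => hne (P.rank_inj x h).symm

theorem weight_of_mem {x : A} (hx : x ∈ P.A1) : P.weight x = P.w1 := if_pos hx

theorem weight_of_notMem {x : A} (hx : x ∉ P.A1) : P.weight x = P.w2 := if_neg hx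

theorem weight_pos (x : A) : 0 < P.weight x := by
  unfold weight
  split_ifs
  · exact P.hw2.trans P.hw12
  · exact P.hw2

theorem weight_le (x : A) : P.weight x ≤ P.w1 := by
  unfold weight
  split_ifs
  · exact le_rfl
  · exact P.hw12.le

theorem compl_F1_nonempty : (Finset.univ \ P.F1).Nonempty := by
  rw [← Finset.card_pos, Finset.card_sdiff_of_subset (Finset.subset_univ _), Finset.card_univ]
  have h1 : P.F1.card ≤ P.A1.card := Finset.card_image_le
  have h2 := Finset.card_le_univ P.A1
  have h3 := P.card_lt
  omega

variable {P}

/-- If everyone in `T` improves by passing from a popular matching `M` to the matching `N`, and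
nobody else is reassigned, then `T` is empty. -/
theorem IsPopular.sum_weight_le_zero {M : A → I} (hM : P.IsPopular M) {N : A → I}
    (hN : Function.Injective N) (T : Finset A) (hT : ∀ a ∈ T, P.Prefers a (N a) (M a))
    (hT' : ∀ a ∉ T, N a = M a) : ∑ a ∈ T, P.weight a ≤ 0 := by
  have h := not_lt.mp (hM.2 N hN)
  refine le_trans ?_ (h.trans (Finset.sum_nonpos fun a _ => ?_))
  · rw [← Finset.sum_filter]
    refine Finset.sum_le_sum_of_subset_of_nonneg (fun a ha => ?_) fun a _ _ => (P.weight_pos a).le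
    simpa using hT a ha
  · by_cases ha : a ∈ T
    · exact (if_neg (not_lt.mpr (le_of_lt (hT a ha)))).le
    · exact (if_neg (by rw [hT' a ha]; exact lt_irrefl _)).le

/-- If everyone in `T` improves by passing from a popular matching `M` to the assignment `N`,
which becomes a matching once `z` is evicted, then `T` does not outweigh `z`. -/
theorem IsPopular.sum_weight_le {M : A → I} (hM : P.IsPopular M) {N : A → I} {z : A}
    (hN : Set.InjOn N {z}ᶜ) (T : Finset A) (hz : z ∉ T)
    (hT : ∀ a ∈ T, P.Prefers a (N a) (M a)) (hT' : ∀ a ∉ T, N a = M a) :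
    ∑ a ∈ T, P.weight a ≤ P.weight z := by
  obtain ⟨f, hf⟩ : ∃ f, f ∉ Finset.univ.image N := by
    by_contra! hall
    have h1 : (Finset.univ.image N) = Finset.univ := Finset.eq_univ_iff_forall.mpr hall
    have h2 : (Finset.univ.image N).card ≤ Fintype.card A := Finset.card_image_le
    rw [h1, Finset.card_univ] at h2
    exact absurd P.card_lt (not_lt.mpr h2)
  have hf' : ∀ a, N a ≠ f := fun a ha => hf (by simp [← ha])
  have hinj : Function.Injective (Function.update N z f) := by
    intro a b hab
    by_cases ha : a = z <;> by_cases hb : b = z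
    · rw [ha, hb]
    · subst ha
      simp only [Function.update_self, Function.update_of_ne hb] at hab
      exact absurd hab.symm (hf' b)
    · subst hb
      simp only [Function.update_self, Function.update_of_ne ha] at hab
      exact absurd hab (hf' a)
    · simp only [Function.update_of_ne ha, Function.update_of_ne hb] at hab
      exact hN ha hb hab
  have h := not_lt.mp (hM.2 _ hinj)
  refine le_trans ?_ (h.trans ?_)
  · rw [← Finset.sum_filter]
    refine Finset.sum_le_sum_of_subset_of_nonneg (fun a ha => ?_) fun a _ _ => (P.weight_pos a).le
    have haz : a ≠ z := fun h => hz (h ▸ ha)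
    simpa [Function.update_of_ne haz] using hT a ha
  · rw [← Finset.sum_filter, ← Finset.sum_singleton P.weight z]
    refine Finset.sum_le_sum_of_subset_of_nonneg (fun a ha => ?_) fun a _ _ => (P.weight_pos a).le
    rw [Finset.mem_singleton]
    by_contra haz
    rw [Finset.mem_filter, Function.update_of_ne haz] at ha
    by_cases haT : a ∈ T
    · exact lt_asymm ha.2 (hT a haT)
    · exact lt_irrefl _ (hT' a haT ▸ ha.2)

/-- In a popular matching, an item preferred by `a` is held by somebody at least as heavy. -/
theorem IsPopular.exists_holder {M : A → I} (hM : P.IsPopular M) {a : A} {p : I}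
    (h : P.Prefers a p (M a)) : ∃ z, z ≠ a ∧ M z = p ∧ P.weight a ≤ P.weight z := by
  have hT : ∀ b ∈ ({a} : Finset A), P.Prefers b (Function.update M a p b) (M b) := by
    intro b hb
    rw [Finset.mem_singleton] at hb
    subst hb
    simpa using h
  have hT' : ∀ b ∉ ({a} : Finset A), Function.update M a p b = M b := by
    intro b hb
    rw [Finset.mem_singleton] at hb
    exact Function.update_of_ne hb _ _
  have key : ∀ S : Set A, (∀ x ∈ S, x ≠ a → M x ≠ p) → Set.InjOn (Function.update M a p) S := by
    intro S hS x hx y hy hxy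
    have hSx := hS x hx
    have hSy := hS y hy
    simp only [Function.update_apply] at hxy
    split_ifs at hxy with h1 h2 h3
    · rw [h1, h2]
    · exact absurd hxy.symm (hSy h2)
    · exact absurd hxy (hSx h1)
    · exact hM.1 hxy
  by_cases hz : ∃ z, M z = p
  · obtain ⟨z, hz⟩ := hz
    have hza : z ≠ a := by
      rintro rfl
      rw [← hz] at h
      exact lt_irrefl _ h
    refine ⟨z, hza, hz, ?_⟩
    have := hM.sum_weight_le (N := Function.update M a p) (z := z) ?_ {a}
      (by simpa using hza) hT hT'
    · simpa using this
    · exact key _ fun x hx _ hxp => hx (hM.1 (hxp.trans hz.symm))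
  · push Not at hz
    have := hM.sum_weight_le_zero (N := Function.update M a p) ?_ {a} hT hT'
    · rw [Finset.sum_singleton] at this
      exact absurd this (not_le.mpr (P.weight_pos a))
    · exact Set.injOn_univ.mp (key _ fun x _ _ => hz x)

/-- In a popular matching, if `a` prefers the item held by `b` and `b` prefers `q`, then `q` is
held by a third applicant at least as heavy as `a` and `b` together. -/
theorem IsPopular.exists_holder_of_pair {M : A → I} (hM : P.IsPopular M) {a b : A} {q : I}
    (ha : P.Prefers a (M b) (M a)) (hb : P.Prefers b q (M b)) :
    ∃ z, z ≠ a ∧ z ≠ b ∧ M z = q ∧ P.weight a + P.weight b ≤ P.weight z := by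
  have hab : a ≠ b := by
    rintro rfl
    exact lt_irrefl _ ha
  have hqb : q ≠ M b := by
    rintro rfl
    exact lt_irrefl _ hb
  set N : A → I := fun x => if x = a then M b else if x = b then q else M x with hN
  have hT : ∀ x ∈ ({a, b} : Finset A), P.Prefers x (N x) (M x) := by
    intro x hx
    rw [Finset.mem_insert, Finset.mem_singleton] at hx
    rcases hx with rfl | rfl
    · simpa [hN] using ha
    · simpa [hN, hab.symm] using hb
  have hT' : ∀ x ∉ ({a, b} : Finset A), N x = M x := by
    intro x hx
    rw [Finset.mem_insert, Finset.mem_singleton, not_or] at hx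
    simp [hN, hx.1, hx.2]
  have hi := hM.1
  have key : ∀ S : Set A, (∀ x ∈ S, x ≠ a → x ≠ b → M x ≠ q) → Set.InjOn N S := by
    intro S hS x hx y hy hxy
    have hSx := hS x hx
    have hSy := hS y hy
    simp only [hN] at hxy
    split_ifs at hxy with h1 h2 h3 h4 h5 h6 h7 h8
    · rw [h1, h2]
    · exact absurd hxy.symm hqb
    · exact absurd (hi hxy).symm h3
    · exact absurd hxy hqb
    · rw [h4, h6]
    · exact absurd hxy.symm (hSy h5 h6)
    · exact absurd (hi hxy) h4
    · exact absurd hxy (hSx h1 h4)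
    · exact hi hxy
  by_cases hz : ∃ z, M z = q ∧ z ≠ a
  · obtain ⟨z, hz, hza⟩ := hz
    have hzb : z ≠ b := by
      rintro rfl
      exact hqb hz.symm
    refine ⟨z, hza, hzb, hz, ?_⟩
    rw [← Finset.sum_pair hab]
    refine hM.sum_weight_le (N := N) (key _ fun x hx _ _ hxq => hx ?_) _
      (by simp [hza, hzb]) hT hT'
    exact hi (hxq.trans hz.symm)
  · push Not at hz
    have := hM.sum_weight_le_zero (N := N)
      (Set.injOn_univ.mp (key _ fun x _ hxa _ hxq => hxa (hz x hxq))) _ hT hT'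
    rw [Finset.sum_pair hab] at this
    linarith [P.weight_pos a, P.weight_pos b]

theorem IsPopular.f1_eq_of_mem_F1 {M : A → I} (hM : P.IsPopular M) {z : A} (hz : M z ∈ P.F1) :
    z ∈ P.A1 ∧ P.f1 z = M z := by
  have hf : ∀ x, P.f1 x ≠ M x → P.Prefers x (P.f1 x) (M x) := fun x hx =>
    P.prefers_bestIn x (Finset.mem_univ _) hx.symm
  obtain ⟨x, hx, hxz⟩ := Finset.mem_image.mp hz
  have hw := P.hw12
  have hw2 := P.hw2
  by_cases hxz' : x = z
  · subst hxz'
    exact ⟨hx, hxz⟩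
  have hpx : P.Prefers x (M z) (M x) := by
    rw [← hxz]
    refine hf x fun h => hxz' (hM.1 ?_)
    rw [← hxz, h]
  have hzA : z ∈ P.A1 := by
    by_contra hzA
    obtain ⟨z', -, hz', hle⟩ := hM.exists_holder hpx
    rw [hM.1 hz', P.weight_of_mem hx, P.weight_of_notMem hzA] at hle
    linarith
  refine ⟨hzA, ?_⟩
  by_contra hne
  obtain ⟨y, -, -, -, hle⟩ := hM.exists_holder_of_pair hpx (hf z hne)
  rw [P.weight_of_mem hx, P.weight_of_mem hzA] at hle
  linarith [P.weight_le y]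

/-- If some popular matching exists, two applicants of the first category sharing their first item
cannot both have an `f2`-item as second item. -/
theorem HasPopular.not_mem_F2 (h : P.HasPopular) {x x' : A} (hx : x ∈ P.A1) (hx' : x' ∈ P.A1)
    (hne : x ≠ x') (hf : P.f1 x = P.f1 x') : ¬ (P.s1 x ∈ P.F2 ∧ P.s1 x' ∈ P.F2) := by
  obtain ⟨M, hM⟩ := h
  have hf1 : ∀ x, P.f1 x ≠ M x → P.Prefers x (P.f1 x) (M x) := fun x hx =>
    P.prefers_bestIn x (Finset.mem_univ _) hx.symm
  have hw := P.hw12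
  have hw2 := P.hw2
  suffices key : ∀ x ∈ P.A1, P.f1 x ≠ M x → P.s1 x ∉ P.F2 by
    rintro ⟨h1, h2⟩
    have e1 : P.f1 x = M x := by
      by_contra hc
      exact key x hx hc h1
    have e2 : P.f1 x' = M x' := by
      by_contra hc
      exact key x' hx' hc h2
    exact hne (hM.1 (by rw [← e1, ← e2, hf]))
  intro x hx hxM hmem
  have hMx : M x ∈ Finset.univ \ P.F1 := by
    rw [Finset.mem_sdiff]
    exact ⟨Finset.mem_univ _, fun hc => hxM (hM.f1_eq_of_mem_F1 hc).2⟩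
  have hs1 : P.s1 x ∉ P.F1 := (Finset.mem_sdiff.mp (P.bestIn_mem x P.compl_F1_nonempty)).2
  obtain ⟨y, hy, hyq⟩ := Finset.mem_image.mp hmem
  have hyA : y ∉ P.A1 := fun hc => Finset.disjoint_left.mp P.disj hc hy
  by_cases hxq : M x = P.s1 x
  · have hMy : M y ∈ Finset.univ \ P.F1 := by
      rw [Finset.mem_sdiff]
      exact ⟨Finset.mem_univ _, fun hc => hyA (hM.f1_eq_of_mem_F1 hc).1⟩
    have hpy : P.Prefers y (M x) (M y) := by
      rw [hxq, ← hyq]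
      refine P.prefers_bestIn y hMy fun hc => hyA ?_
      have : M y = M x := by rw [hxq, ← hyq]; exact hc
      rwa [hM.1 this]
    obtain ⟨z, -, -, -, hle⟩ := hM.exists_holder_of_pair hpy (hf1 x hxM)
    rw [P.weight_of_mem hx, P.weight_of_notMem hyA] at hle
    linarith [P.weight_le z]
  · have hpx : P.Prefers x (P.s1 x) (M x) := P.prefers_bestIn x hMx hxq
    obtain ⟨z, -, hz, hle⟩ := hM.exists_holder hpx
    have hzA : z ∈ P.A1 := by
      by_contra hzA
      rw [P.weight_of_mem hx, P.weight_of_notMem hzA] at hle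
      linarith
    rw [← hz] at hpx hs1
    have hfz : P.f1 z ≠ M z := fun hc =>
      hs1 (hc ▸ Finset.mem_image_of_mem _ hzA)
    obtain ⟨y, -, -, -, hle'⟩ := hM.exists_holder_of_pair hpx (hf1 z hfz)
    rw [P.weight_of_mem hx, P.weight_of_mem hzA] at hle'
    linarith [P.weight_le y]

end TwoWPM

/-- A second-moment bound: if the events `G v`, `v ∈ W`, all have density `γ` in `S` and are
pairwise nonpositively correlated, then few points of `S` lie in at most `μ / 2` of them, where `μ`
is at most the expected number `|W| γ`. -/
theorem card_filter_card_le_half_le {Ω V : Type*} (S : Finset Ω) (W : Finset V)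
    (G : V → Ω → Prop) [∀ v, DecidablePred (G v)] (γ μ : ℝ) (hμ : 0 < μ) (hμγ : μ ≤ #W * γ)
    (h1 : ∀ v ∈ W, (#{ω ∈ S | G v ω} : ℝ) = γ * #S)
    (h2 : ∀ u ∈ W, ∀ v ∈ W, u ≠ v → (#{ω ∈ S | G u ω ∧ G v ω} : ℝ) ≤ γ ^ 2 * #S) :
    (#{ω ∈ S | (#{v ∈ W | G v ω} : ℝ) ≤ μ / 2} : ℝ) ≤ 4 / μ * #S := by
  set X : Ω → ℝ := fun ω => ∑ v ∈ W, if G v ω then 1 else 0 with hX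
  have hXc : ∀ ω, (#{v ∈ W | G v ω} : ℝ) = X ω := fun ω => by simp [hX]
  simp only [hXc]
  set e : ℝ := #W * γ with he
  have he0 : 0 < e := hμ.trans_le hμγ
  have hγ : 0 ≤ γ := by
    by_contra hγ
    have : e ≤ 0 := mul_nonpos_of_nonneg_of_nonpos (Nat.cast_nonneg _) (not_le.mp hγ).le
    linarith
  have hfst : ∑ ω ∈ S, X ω = e * #S := by
    simp only [hX]
    rw [Finset.sum_comm]
    have : ∀ v ∈ W, (∑ ω ∈ S, if G v ω then (1 : ℝ) else 0) = γ * #S := fun v hv => by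
      rw [← h1 v hv]; simp
    rw [Finset.sum_congr rfl this, Finset.sum_const, nsmul_eq_mul, he]
    ring
  have hsnd : ∑ ω ∈ S, X ω ^ 2 ≤ (e + e ^ 2) * #S := by
    have h3 : ∀ ω, X ω ^ 2 = ∑ u ∈ W, ∑ v ∈ W, if G u ω ∧ G v ω then (1 : ℝ) else 0 := by
      intro ω
      simp only [hX, sq, Finset.sum_mul_sum]
      refine Finset.sum_congr rfl fun u _ => Finset.sum_congr rfl fun v _ => ?_
      by_cases hu : G u ω <;> by_cases hv : G v ω <;> simp [hu, hv]
    simp only [h3]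
    rw [Finset.sum_comm]
    have h4 : ∀ u ∈ W, (∑ ω ∈ S, ∑ v ∈ W, if G u ω ∧ G v ω then (1 : ℝ) else 0)
        ≤ (γ + #W * γ ^ 2) * #S := by
      intro u hu
      rw [Finset.sum_comm]
      have h5 : ∀ v ∈ W, (∑ ω ∈ S, if G u ω ∧ G v ω then (1 : ℝ) else 0)
          ≤ (if u = v then γ * #S else 0) + γ ^ 2 * #S := by
        intro v hv
        have h6 : (∑ ω ∈ S, if G u ω ∧ G v ω then (1 : ℝ) else 0)
          = (#{ω ∈ S | G u ω ∧ G v ω} : ℝ) := by simp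
        rw [h6]
        split_ifs with huv
        · subst huv
          simp only [and_self, h1 u hu]
          have : 0 ≤ γ ^ 2 * (#S : ℝ) := by positivity
          linarith
        · linarith [h2 u hu v hv huv]
      refine (Finset.sum_le_sum h5).trans (le_of_eq ?_)
      rw [Finset.sum_add_distrib, Finset.sum_ite_eq, if_pos hu, Finset.sum_const, nsmul_eq_mul]
      ring
    refine (Finset.sum_le_sum h4).trans (le_of_eq ?_)
    rw [Finset.sum_const, nsmul_eq_mul, he]
    ring
  have hvar : ∑ ω ∈ S, (X ω - e) ^ 2 ≤ e * #S := by
    have : ∑ ω ∈ S, (X ω - e) ^ 2 = ∑ ω ∈ S, X ω ^ 2 - 2 * e * ∑ ω ∈ S, X ω + e ^ 2 * #S := by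
      rw [Finset.mul_sum, ← Finset.sum_sub_distrib, mul_comm (e ^ 2), ← nsmul_eq_mul,
        ← Finset.sum_const, ← Finset.sum_add_distrib]
      exact Finset.sum_congr rfl fun ω _ => by ring
    rw [this, hfst]
    linarith
  have hlow : (#{ω ∈ S | X ω ≤ μ / 2} : ℝ) * (e ^ 2 / 4) ≤ ∑ ω ∈ S, (X ω - e) ^ 2 := by
    rw [← nsmul_eq_mul, ← Finset.sum_const]
    refine (Finset.sum_le_sum fun ω hω => ?_).trans
      (Finset.sum_le_sum_of_subset_of_nonneg (Finset.filter_subset _ _) fun _ _ _ => sq_nonneg _)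
    have := (Finset.mem_filter.mp hω).2
    nlinarith
  have hfin : (#{ω ∈ S | X ω ≤ μ / 2} : ℝ) ≤ 4 / e * #S := by
    have h7 := hlow.trans hvar
    rw [div_mul_eq_mul_div, le_div_iff₀ he0]
    nlinarith
  exact hfin.trans (by gcongr)

/-- A bound on densities can be checked fibre by fibre. -/
theorem card_filter_le_of_fibers {Ω Λ : Type*} [Fintype Ω] [DecidableEq Λ] (Φ : Ω → Λ) (B : Ω → Prop)
    [DecidablePred B] (η : ℝ)
    (h : ∀ ω₀, (#{ω | B ω ∧ Φ ω = Φ ω₀} : ℝ) ≤ η * #{ω | Φ ω = Φ ω₀}) :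
    (#{ω | B ω} : ℝ) ≤ η * Fintype.card Ω := by
  have h1 : #{ω | B ω} = ∑ l ∈ Finset.univ.image Φ, #{ω ∈ {ω | B ω} | Φ ω = l} :=
    Finset.card_eq_sum_card_fiberwise fun ω _ => Finset.mem_coe.mpr
      (Finset.mem_image_of_mem _ (Finset.mem_univ _))
  have h2 : Fintype.card Ω = ∑ l ∈ Finset.univ.image Φ, #{ω | Φ ω = l} :=
    Finset.card_eq_sum_card_fiberwise (s := Finset.univ) fun ω _ => Finset.mem_coe.mpr
      (Finset.mem_image_of_mem _ (Finset.mem_univ _))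
  rw [h1, h2, Nat.cast_sum, Nat.cast_sum, Finset.mul_sum]
  refine Finset.sum_le_sum fun l hl => ?_
  obtain ⟨ω₀, -, rfl⟩ := Finset.mem_image.mp hl
  rw [Finset.filter_filter]
  exact h ω₀

/-- The density of a cylinder in a product. -/
theorem card_piFinset_filter_forall {N E : Type*} [Fintype N] [DecidableEq N] (C : N → Finset E)
    (S : Finset N) (p : E → Prop) [DecidablePred p] (q : ℝ)
    (h : ∀ x ∈ S, (#{s ∈ C x | p s} : ℝ) = q * #(C x)) :
    (#{σ ∈ Fintype.piFinset C | ∀ x ∈ S, p (σ x)} : ℝ) = q ^ #S * #(Fintype.piFinset C) := by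
  have h1 : {σ ∈ Fintype.piFinset C | ∀ x ∈ S, p (σ x)} =
      Fintype.piFinset fun x => if x ∈ S then {s ∈ C x | p s} else C x := by
    ext σ
    simp only [Finset.mem_filter, Fintype.mem_piFinset]
    constructor
    · rintro ⟨h1, h2⟩ x
      by_cases hx : x ∈ S <;> simp [hx, h1 x]
      exact h2 x hx
    · intro h1
      refine ⟨fun x => ?_, fun x hx => ?_⟩
      · have := h1 x
        by_cases hx : x ∈ S <;> simp [hx] at this
        · exact this.1
        · exact this
      · have := h1 x
        simp [hx] at this
        exact this.2
  rw [h1, Fintype.card_piFinset, Fintype.card_piFinset, Nat.cast_prod, Nat.cast_prod]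
  have h2 : q ^ #S = ∏ x : N, if x ∈ S then q else 1 := by simp
  rw [h2, ← Finset.prod_mul_distrib]
  refine Finset.prod_congr rfl fun x _ => ?_
  by_cases hx : x ∈ S <;> simp [hx, h x]

theorem card_filter_and_add {Ω : Type*} (S : Finset Ω) (p q : Ω → Prop)
    [DecidablePred p] [DecidablePred q] :
    #{ω ∈ S | p ω ∧ q ω} + #{ω ∈ S | ¬ p ω} + #{ω ∈ S | ¬ q ω} =
      #S + #{ω ∈ S | ¬ p ω ∧ ¬ q ω} := by
  rw [Finset.card_eq_sum_ones S]
  simp only [Finset.card_filter]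
  rw [← Finset.sum_add_distrib, ← Finset.sum_add_distrib, ← Finset.sum_add_distrib]
  refine Finset.sum_congr rfl fun ω _ => ?_
  by_cases hp : p ω <;> by_cases hq : q ω <;> simp [hp, hq]

theorem one_sub_inv_pow_le {r : ℝ} (hr : 1 ≤ r) (t : ℕ) : (1 - 1 / r) ^ t ≤ 1 - t / (r + t) := by
  have hr0 : 0 < r := by linarith
  have hi : 1 / r ≤ 1 := by rw [div_le_one hr0]; exact hr
  have hi0 : 0 < 1 / r := by positivity
  have h1 : 1 + (t : ℝ) * (1 / r) ≤ (1 + 1 / r) ^ t := one_add_mul_le_pow (by linarith) t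
  have h2 : (1 - 1 / r) ^ t * (1 + 1 / r) ^ t ≤ 1 := by
    rw [← mul_pow]
    refine pow_le_one₀ (mul_nonneg (by linarith) (by linarith)) ?_
    nlinarith
  have h3 : (1 - 1 / r) ^ t * (1 + (t : ℝ) * (1 / r)) ≤ 1 :=
    (mul_le_mul_of_nonneg_left h1 (pow_nonneg (by linarith) _)).trans h2
  have h4 : 1 - (t : ℝ) / (r + t) = 1 / (1 + t * (1 / r)) := by
    field_simp
    ring
  rw [h4, le_div_iff₀ (by positivity)]
  exact h3

/-- If the coordinates in `T` of a random point of a product have values `ev (σ x)` uniform on `R`,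
then typically a proportion of order `|T| / (|R| + |T|)` of any `W ⊆ R` is attained. -/
theorem card_few_hits_le {N E I : Type*} [Fintype N] [DecidableEq N] [DecidableEq I]
    (C : N → Finset E)
    (T : Finset N) (ev : E → I) (R W : Finset I) (hWR : W ⊆ R)
    (hC : ∀ x ∈ T, ∀ q ∈ R, (#{s ∈ C x | ev s = q} : ℝ) = #(C x) / #R)
    (μ : ℝ) (hμ : 0 < μ) (hμW : μ ≤ #W * (#T / (#R + #T))) :
    (#{σ ∈ Fintype.piFinset C | (#{v ∈ W | ∃ x ∈ T, ev (σ x) = v} : ℝ) ≤ μ / 2} : ℝ) ≤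
      4 / μ * #(Fintype.piFinset C) := by
  have hW : W.Nonempty := by
    rw [Finset.nonempty_iff_ne_empty]
    rintro rfl
    simp at hμW
    linarith
  have hR1 : (1 : ℝ) ≤ #R := by
    exact_mod_cast Finset.card_pos.mpr (hW.mono hWR)
  have hR0 : (#R : ℝ) ≠ 0 := by linarith
  set s : ℝ := (#(Fintype.piFinset C) : ℝ) with hs
  have hs0 : 0 ≤ s := Nat.cast_nonneg _
  set β : ℝ := (1 - 1 / #R) ^ #T with hβ
  have hmiss : ∀ v ∈ W, (#{σ ∈ Fintype.piFinset C | ¬ ∃ x ∈ T, ev (σ x) = v} : ℝ) = β * s := by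
    intro v hv
    have h0 : ∀ σ : N → E, (¬ ∃ x ∈ T, ev (σ x) = v) ↔ ∀ x ∈ T, ev (σ x) ≠ v := by
      intro σ
      push Not
      rfl
    simp only [h0]
    refine card_piFinset_filter_forall C T (fun s => ev s ≠ v) (1 - 1 / #R) fun x hx => ?_
    have h1 := Finset.card_filter_add_card_filter_not (s := C x) (fun s => ev s = v)
    have h2 : (#{s ∈ C x | ev s = v} : ℝ) + #{s ∈ C x | ¬ ev s = v} = #(C x) := by exact_mod_cast h1
    rw [hC x hx v (hWR hv)] at h2
    rw [sub_mul, one_mul, eq_sub_iff_add_eq']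
    linear_combination h2
  have hmiss2 : ∀ u ∈ W, ∀ v ∈ W, u ≠ v →
      (#{σ ∈ Fintype.piFinset C |
        (¬ ∃ x ∈ T, ev (σ x) = u) ∧ ¬ ∃ x ∈ T, ev (σ x) = v} : ℝ) ≤ β ^ 2 * s := by
    intro u hu v hv huv
    have h1 : (#{σ ∈ Fintype.piFinset C | ∀ x ∈ T, ev (σ x) ≠ u ∧ ev (σ x) ≠ v} : ℝ)
        = (1 - 2 / #R) ^ #T * s := by
      refine card_piFinset_filter_forall C T (fun s => ev s ≠ u ∧ ev s ≠ v) _ fun x hx => ?_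
      have h1 := card_filter_and_add (C x) (fun s => ev s ≠ u) (fun s => ev s ≠ v)
      have h3 : #{s ∈ C x | ¬ ev s ≠ u ∧ ¬ ev s ≠ v} = 0 := by
        rw [Finset.card_eq_zero, Finset.filter_eq_empty_iff]
        rintro s - ⟨h1, h2⟩
        rw [not_not] at h1 h2
        exact huv (h1.symm.trans h2)
      rw [h3] at h1
      simp only [ne_eq, not_not] at h1
      have h2 : (#{s ∈ C x | ¬ ev s = u ∧ ¬ ev s = v} : ℝ) + #{s ∈ C x | ev s = u}
        + #{s ∈ C x | ev s = v} = #(C x) := by exact_mod_cast h1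
      rw [hC x hx u (hWR hu), hC x hx v (hWR hv)] at h2
      rw [sub_mul, one_mul, eq_sub_iff_add_eq']
      simp only [ne_eq]
      linear_combination h2
    have h2 : (2 : ℝ) ≤ #R := by
      have : 1 < #R := Finset.one_lt_card.mpr ⟨u, hWR hu, v, hWR hv, huv⟩
      exact_mod_cast this
    have h3 : (1 - 2 / (#R : ℝ)) ^ #T ≤ β ^ 2 := by
      rw [hβ, ← pow_mul, mul_comm, pow_mul]
      refine pow_le_pow_left₀ ?_ ?_ _
      · rw [sub_nonneg, div_le_one (by linarith)]
        exact h2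
      · have : 0 ≤ (1 / (#R : ℝ)) ^ 2 := sq_nonneg _
        linear_combination this
    refine le_trans (le_of_eq ?_) (mul_le_mul_of_nonneg_right h3 hs0)
    rw [← h1]
    have h0 : ∀ σ : N → E, ((¬ ∃ x ∈ T, ev (σ x) = u) ∧ ¬ ∃ x ∈ T, ev (σ x) = v) ↔
        ∀ x ∈ T, ev (σ x) ≠ u ∧ ev (σ x) ≠ v := by
      intro σ
      push Not
      exact ⟨fun h x hx => ⟨h.1 x hx, h.2 x hx⟩, fun h => ⟨fun x hx => (h x hx).1,
        fun x hx => (h x hx).2⟩⟩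
    simp only [h0]
  refine card_filter_card_le_half_le (Fintype.piFinset C) W
    (fun v σ => ∃ x ∈ T, ev (σ x) = v) (1 - β) μ hμ (hμW.trans ?_) ?_ ?_
  · gcongr
    linarith [one_sub_inv_pow_le hR1 #T]
  · intro v hv
    have h1 := Finset.card_filter_add_card_filter_not (s := Fintype.piFinset C)
      (fun σ => ∃ x ∈ T, ev (σ x) = v)
    have h2 : (#{σ ∈ Fintype.piFinset C | ∃ x ∈ T, ev (σ x) = v} : ℝ) +
      #{σ ∈ Fintype.piFinset C | ¬ ∃ x ∈ T, ev (σ x) = v} = s := by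
      rw [hs]
      exact_mod_cast h1
    rw [hmiss v hv] at h2
    linarith
  · intro u hu v hv huv
    have h1 := card_filter_and_add (Fintype.piFinset C)
      (fun σ => ∃ x ∈ T, ev (σ x) = u) (fun σ => ∃ x ∈ T, ev (σ x) = v)
    have h2 : (#{σ ∈ Fintype.piFinset C |
          (∃ x ∈ T, ev (σ x) = u) ∧ ∃ x ∈ T, ev (σ x) = v} : ℝ) +
        #{σ ∈ Fintype.piFinset C | ¬ ∃ x ∈ T, ev (σ x) = u} +
        #{σ ∈ Fintype.piFinset C | ¬ ∃ x ∈ T, ev (σ x) = v} =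
        s + #{σ ∈ Fintype.piFinset C |
          (¬ ∃ x ∈ T, ev (σ x) = u) ∧ ¬ ∃ x ∈ T, ev (σ x) = v} := by
      rw [hs]
      exact_mod_cast h1
    have h3 := hmiss2 u hu v hv huv
    rw [hmiss u hu, hmiss v hv] at h2
    linarith

/-- The item of `R` ranked first by `s` (junk value if `R = ∅`). -/
def best {m : ℕ} (R : Finset (Fin m)) (hm : 0 < m) (s : Fin m ≃ Fin m) : Fin m :=
  if hR : R.Nonempty then (Finset.exists_min_image R s hR).choose else ⟨0, hm⟩

section Best

variable {m : ℕ} {R : Finset (Fin m)} (hm : 0 < m)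

theorem best_mem (hR : R.Nonempty) (s : Fin m ≃ Fin m) : best R hm s ∈ R := by
  unfold best
  rw [dif_pos hR]
  exact (Finset.exists_min_image R s hR).choose_spec.1

theorem best_le (s : Fin m ≃ Fin m) {q : Fin m} (hq : q ∈ R) : s (best R hm s) ≤ s q := by
  have hR : R.Nonempty := ⟨q, hq⟩
  unfold best
  rw [dif_pos hR]
  exact (Finset.exists_min_image R s hR).choose_spec.2 q hq

theorem best_eq {s : Fin m ≃ Fin m} {b : Fin m} (hb : b ∈ R) (h : ∀ q ∈ R, s b ≤ s q) :
    best R hm s = b :=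
  s.injective (le_antisymm (best_le hm s hb) (h _ (best_mem hm ⟨b, hb⟩ s)))

theorem best_swap_trans {q q' : Fin m} (hR : R.Nonempty) (hq : q ∈ R ↔ q' ∈ R)
    (s : Fin m ≃ Fin m) :
    best R hm ((Equiv.swap q q').trans s) = Equiv.swap q q' (best R hm s) := by
  have hmem : ∀ z ∈ R, Equiv.swap q q' z ∈ R := by
    intro z hz
    rw [Equiv.swap_apply_def]
    split_ifs with h1 h2
    · exact hq.mp (h1 ▸ hz)
    · exact hq.mpr (h2 ▸ hz)
    · exact hz
  refine best_eq hm (hmem _ (best_mem hm hR s)) fun z hz => ?_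
  simp only [Equiv.trans_apply, Equiv.swap_apply_self]
  exact best_le hm s (hmem z hz)

/-- On a set of rankings invariant under swapping elements of `R`, the first item in `R` is
uniformly distributed on `R`. -/
theorem card_best_eq (C : Finset (Fin m ≃ Fin m))
    (hC : ∀ q ∈ R, ∀ q' ∈ R, ∀ s ∈ C, (Equiv.swap q q').trans s ∈ C) {q : Fin m} (hq : q ∈ R) :
    (#{s ∈ C | best R hm s = q} : ℝ) = #C / #R := by
  have hR : R.Nonempty := ⟨q, hq⟩
  have heq : ∀ q' ∈ R, #{s ∈ C | best R hm s = q'} = #{s ∈ C | best R hm s = q} := by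
    intro q' hq'
    refine Finset.card_bij' (fun s _ => (Equiv.swap q q').trans s)
      (fun s _ => (Equiv.swap q q').trans s) ?_ ?_ ?_ ?_
    · intro s hs
      rw [Finset.mem_filter] at hs ⊢
      refine ⟨hC q hq q' hq' s hs.1, ?_⟩
      rw [best_swap_trans hm hR (by simp [hq, hq']), hs.2, Equiv.swap_apply_right]
    · intro s hs
      rw [Finset.mem_filter] at hs ⊢
      refine ⟨hC q hq q' hq' s hs.1, ?_⟩
      rw [best_swap_trans hm hR (by simp [hq, hq']), hs.2, Equiv.swap_apply_left]
    · intro s _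
      ext z
      simp
    · intro s _
      ext z
      simp
  have hsum : #C = ∑ q' ∈ R, #{s ∈ C | best R hm s = q'} :=
    Finset.card_eq_sum_card_fiberwise fun s _ => Finset.mem_coe.mpr (best_mem hm hR s)
  rw [Finset.sum_congr rfl heq, Finset.sum_const, smul_eq_mul] at hsum
  rw [eq_div_iff (by exact_mod_cast (Finset.card_pos.mpr hR).ne'), hsum]
  push_cast
  ring

theorem card_best_univ_eq {q : Fin m} (hq : q ∈ R) :
    (#{s ∈ (Finset.univ : Finset (Fin m ≃ Fin m)) | best R hm s = q} : ℝ) =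
      #(Finset.univ : Finset (Fin m ≃ Fin m)) / #R :=
  card_best_eq hm _ (fun _ _ _ _ _ _ => Finset.mem_univ _) hq

theorem card_best_top_eq {p : Fin m} (hp : p ∉ R) {q : Fin m} (hq : q ∈ R) :
    (#{s ∈ {s : Fin m ≃ Fin m | best Finset.univ hm s = p} | best R hm s = q} : ℝ) =
      #{s : Fin m ≃ Fin m | best Finset.univ hm s = p} / #R := by
  refine card_best_eq hm _ (fun q hq q' hq' s hs => ?_) hq
  rw [Finset.mem_filter] at hs ⊢
  refine ⟨Finset.mem_univ _, ?_⟩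
  rw [best_swap_trans hm ⟨q, Finset.mem_univ _⟩ (by simp), hs.2,
    Equiv.swap_apply_of_ne_of_ne] <;> rintro rfl <;> contradiction

end Best

/-- A density bound in a product can be checked on the boxes of a partition into boxes. -/
theorem card_filter_le_of_boxes {N E : Type*} [Fintype N] [DecidableEq N] [Fintype E]
    (C : (N → E) → N → Finset E) (hself : ∀ σ x, σ x ∈ C σ x)
    (hC : ∀ σ₀ σ, (∀ x, σ x ∈ C σ₀ x) → C σ = C σ₀) (B : (N → E) → Prop)
    [DecidablePred B] (η : ℝ)
    (h : ∀ σ₀, (#{σ ∈ Fintype.piFinset (C σ₀) | B σ} : ℝ) ≤ η * #(Fintype.piFinset (C σ₀))) :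
    (#{σ | B σ} : ℝ) ≤ η * Fintype.card (N → E) := by
  refine card_filter_le_of_fibers C B η fun σ₀ => ?_
  have h1 : ({σ | C σ = C σ₀} : Finset (N → E)) = Fintype.piFinset (C σ₀) := by
    ext σ
    simp only [Finset.mem_filter, Finset.mem_univ, true_and, Fintype.mem_piFinset]
    exact ⟨fun h x => h ▸ hself σ x, hC σ₀ σ⟩
  have h2 : ({σ | B σ ∧ C σ = C σ₀} : Finset (N → E)) =
      {σ ∈ Fintype.piFinset (C σ₀) | B σ} := by
    rw [← h1, Finset.filter_filter]
    simp only [and_comm]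
  rw [h1, h2]
  exact h σ₀

section Profile

variable {N : Type*} {m : ℕ} (hm : 0 < m) {A₁ X X' : Finset N}

/-- The items that are not the first choice of anybody in `A₁`. -/
def leftover (A₁ : Finset N) (σ : N → (Fin m ≃ Fin m)) : Finset (Fin m) :=
  Finset.univ \ A₁.image fun x => best Finset.univ hm (σ x)

theorem leftover_congr {σ σ' : N → (Fin m ≃ Fin m)}
    (h : ∀ x ∈ A₁, best Finset.univ hm (σ x) = best Finset.univ hm (σ' x)) :
    leftover hm A₁ σ = leftover hm A₁ σ' := by
  unfold leftover
  rw [Finset.image_congr fun x hx => h x hx]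

theorem card_leftover_le (σ : N → (Fin m ≃ Fin m)) : #(leftover hm A₁ σ) ≤ m :=
  (Finset.card_le_univ _).trans_eq (Fintype.card_fin m)

variable [Fintype N] [DecidableEq N]

/-- The best leftover items of the applicants outside `A₁`. -/
def leftoverFirst (A₁ : Finset N) (σ : N → (Fin m ≃ Fin m)) : Finset (Fin m) :=
  A₁ᶜ.image fun y => best (leftover hm A₁ σ) hm (σ y)

/-- The items that are the first choice of somebody in `X`. -/
def firstHits (X : Finset N) (σ : N → (Fin m ≃ Fin m)) : Finset (Fin m) :=
  {v ∈ Finset.univ | ∃ x ∈ X, best Finset.univ hm (σ x) = v}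

/-- The items that are the first choice of somebody in `X` and of somebody in `X'`. -/
def commonHits (X X' : Finset N) (σ : N → (Fin m ≃ Fin m)) : Finset (Fin m) :=
  {v ∈ firstHits hm X σ | ∃ x ∈ X', best Finset.univ hm (σ x) = v}

/-- No two applicants in `A₁` share their first choice while their best leftover items are both
best leftover items of applicants outside `A₁`. -/
def NoConflict (A₁ : Finset N) (σ : N → (Fin m ≃ Fin m)) : Prop :=
  ∀ x ∈ A₁, ∀ x' ∈ A₁, x ≠ x' → best Finset.univ hm (σ x) = best Finset.univ hm (σ x') →
    ¬ (best (leftover hm A₁ σ) hm (σ x) ∈ leftoverFirst hm A₁ σ ∧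
      best (leftover hm A₁ σ) hm (σ x') ∈ leftoverFirst hm A₁ σ)

theorem card_compl_le_card_leftover (hN : Fintype.card N ≤ m) (σ : N → (Fin m ≃ Fin m)) :
    #A₁ᶜ ≤ #(leftover hm A₁ σ) := by
  unfold leftover
  rw [Finset.card_sdiff_of_subset (Finset.subset_univ _), Finset.card_univ, Fintype.card_fin,
    Finset.card_compl]
  have : #(A₁.image fun x => best Finset.univ hm (σ x)) ≤ #A₁ := Finset.card_image_le
  omega

theorem card_firstHits_le (hX : 0 < #X) (hXm : #X ≤ m) :
    (#{σ : N → (Fin m ≃ Fin m) | (#(firstHits hm X σ) : ℝ) ≤ #X / 4} : ℝ) ≤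
      8 / #X * Fintype.card (N → (Fin m ≃ Fin m)) := by
  have hX0 : (0 : ℝ) < #X := by exact_mod_cast hX
  have hXm' : (#X : ℝ) ≤ m := by exact_mod_cast hXm
  have h := card_few_hits_le (N := N) (fun _ => (Finset.univ : Finset (Fin m ≃ Fin m))) X
    (best Finset.univ hm) Finset.univ Finset.univ subset_rfl
    (fun x _ q hq => card_best_univ_eq hm hq) (#X / 2) (by positivity) (by
      rw [Finset.card_univ, Fintype.card_fin, ← mul_div_assoc,
        div_le_div_iff₀ (by norm_num) (by linarith)]
      nlinarith)
  rw [Fintype.piFinset_univ, Finset.card_univ] at h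
  have e1 : (#X / 2 / 2 : ℝ) = #X / 4 := by ring
  have e2 : (4 / (#X / 2) : ℝ) = 8 / #X := by field_simp; norm_num
  rw [e1, e2] at h
  exact h

theorem card_commonHits_le (hXX' : Disjoint X X') (hX : 0 < #X) (hXm : #X ≤ m)
    (hcard : #X' = #X) :
    (#{σ : N → (Fin m ≃ Fin m) | (#X : ℝ) / 4 < #(firstHits hm X σ) ∧
      (#(commonHits hm X X' σ) : ℝ) ≤ #X ^ 2 / (16 * m)} : ℝ) ≤
      32 * m / #X ^ 2 * Fintype.card (N → (Fin m ≃ Fin m)) := by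
  have hX0 : (0 : ℝ) < #X := by exact_mod_cast hX
  have hXm' : (#X : ℝ) ≤ m := by exact_mod_cast hXm
  have hm0 : (0 : ℝ) < m := by exact_mod_cast hm
  refine card_filter_le_of_boxes
    (fun σ₀ x => if x ∈ X then {σ₀ x} else Finset.univ) ?_ ?_ _ _ fun σ₀ => ?_
  · intro σ x
    split_ifs <;> simp
  · intro σ₀ σ h
    funext x
    have := h x
    split_ifs at this ⊢
    · rw [Finset.mem_singleton.mp this]
    · rfl
  · set C : N → Finset (Fin m ≃ Fin m) := fun x => if x ∈ X then {σ₀ x} else Finset.univ with hC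
    have hhits : ∀ σ ∈ Fintype.piFinset C, firstHits hm X σ = firstHits hm X σ₀ := by
      intro σ hσ
      rw [Fintype.mem_piFinset] at hσ
      refine Finset.filter_congr fun v _ => exists_congr fun x => and_congr_right fun hx => ?_
      have := hσ x
      simp only [hC, if_pos hx, Finset.mem_singleton] at this
      rw [this]
    by_cases hbig : (#X : ℝ) / 4 < #(firstHits hm X σ₀)
    · have h := card_few_hits_le C X' (best Finset.univ hm) Finset.univ (firstHits hm X σ₀)
        (Finset.subset_univ _) (fun x hx q hq => by
          have hx' : x ∉ X := fun hc => Finset.disjoint_left.mp hXX' hc hx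
          simp only [hC, if_neg hx']
          exact card_best_univ_eq hm hq) (#X ^ 2 / (8 * m)) (by positivity) (by
            rw [Finset.card_univ, Fintype.card_fin, hcard]
            calc (#X : ℝ) ^ 2 / (8 * m) = #X / 4 * (#X / (m + m)) := by field_simp; norm_num
              _ ≤ _ := by gcongr)
      have e1 : ((#X : ℝ) ^ 2 / (8 * m) / 2 : ℝ) = #X ^ 2 / (16 * m) := by field_simp; norm_num
      have e2 : (4 / (#X ^ 2 / (8 * m)) : ℝ) = 32 * m / #X ^ 2 := by field_simp; norm_num
      rw [e1, e2] at h
      refine le_trans (Nat.cast_le.mpr (Finset.card_le_card fun σ hσ => ?_)) h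
      rw [Finset.mem_filter] at hσ ⊢
      obtain ⟨hσ, -, h2⟩ := hσ
      refine ⟨hσ, ?_⟩
      rw [commonHits, hhits σ hσ] at h2
      exact h2
    · rw [Finset.filter_false_of_mem]
      · simp only [Finset.card_empty, Nat.cast_zero]
        positivity
      · rintro σ hσ ⟨h1, -⟩
        rw [hhits σ hσ] at h1
        exact hbig h1

theorem card_leftoverFirst_le (hN : Fintype.card N ≤ m) (hA : 0 < #A₁ᶜ) :
    (#{σ : N → (Fin m ≃ Fin m) | (#(leftoverFirst hm A₁ σ) : ℝ) ≤ #A₁ᶜ / 4} : ℝ) ≤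
      8 / #A₁ᶜ * Fintype.card (N → (Fin m ≃ Fin m)) := by
  have hA0 : (0 : ℝ) < #A₁ᶜ := by exact_mod_cast hA
  refine card_filter_le_of_boxes (fun σ₀ x => if x ∈ A₁ then
    Finset.univ.filter fun s => best Finset.univ hm s = best Finset.univ hm (σ₀ x) else Finset.univ)
    ?_ ?_ _ _
    fun σ₀ => ?_
  · intro σ x
    split_ifs <;> simp
  · intro σ₀ σ h
    funext x
    have := h x
    split_ifs at this ⊢
    · rw [(Finset.mem_filter.mp this).2]
    · rfl
  · set C : N → Finset (Fin m ≃ Fin m) := fun x => if x ∈ A₁ then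
      Finset.univ.filter fun s => best Finset.univ hm s = best Finset.univ hm (σ₀ x) else Finset.univ with hC
    set R := leftover hm A₁ σ₀ with hR
    have hRA : (#A₁ᶜ : ℝ) ≤ #R := by exact_mod_cast card_compl_le_card_leftover hm hN σ₀
    have hRne : R.Nonempty := by
      rw [← Finset.card_pos]
      exact hA.trans_le (card_compl_le_card_leftover hm hN σ₀)
    have hfirst : ∀ σ ∈ Fintype.piFinset C,
        leftoverFirst hm A₁ σ = {v ∈ R | ∃ x ∈ A₁ᶜ, best R hm (σ x) = v} := by
      intro σ hσ
      rw [Fintype.mem_piFinset] at hσ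
      have hRσ : leftover hm A₁ σ = R := leftover_congr hm fun x hx => by
        have := hσ x
        simp only [hC, if_pos hx, Finset.mem_filter] at this
        exact this.2
      ext v
      rw [leftoverFirst, hRσ, Finset.mem_image, Finset.mem_filter]
      refine ⟨fun h => ⟨?_, h⟩, fun h => h.2⟩
      obtain ⟨x, -, rfl⟩ := h
      exact best_mem hm hRne _
    have h := card_few_hits_le C A₁ᶜ (best R hm) R R subset_rfl (fun x hx q hq => by
      simp only [hC, if_neg (Finset.mem_compl.mp hx)]
      exact card_best_univ_eq hm hq) (#A₁ᶜ / 2) (by positivity) (by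
        rw [← mul_div_assoc, div_le_div_iff₀ (by norm_num) (by linarith)]
        nlinarith)
    have e1 : (#A₁ᶜ / 2 / 2 : ℝ) = #A₁ᶜ / 4 := by ring
    have e2 : (4 / (#A₁ᶜ / 2) : ℝ) = 8 / #A₁ᶜ := by field_simp; norm_num
    rw [e1, e2] at h
    refine le_trans (Nat.cast_le.mpr (Finset.card_le_card fun σ hσ => ?_)) h
    rw [Finset.mem_filter] at hσ ⊢
    obtain ⟨hσ, h2⟩ := hσ
    refine ⟨hσ, ?_⟩
    rw [hfirst σ hσ] at h2
    exact h2

theorem card_noConflict_and_le (hN : Fintype.card N ≤ m) (hXA : X ⊆ A₁) (hXA' : X' ⊆ A₁)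
    (hXX' : Disjoint X X') (hX : 0 < #X) (hA : 0 < #A₁ᶜ) :
    (#{σ : N → (Fin m ≃ Fin m) | NoConflict hm A₁ σ ∧
      (#X : ℝ) ^ 2 / (16 * m) < #(commonHits hm X X' σ) ∧
      (#A₁ᶜ : ℝ) / 4 < #(leftoverFirst hm A₁ σ)} : ℝ) ≤
      1024 * m ^ 3 / (#X ^ 2 * #A₁ᶜ ^ 2) * Fintype.card (N → (Fin m ≃ Fin m)) := by
  have hX0 : (0 : ℝ) < #X := by exact_mod_cast hX
  have hA0 : (0 : ℝ) < #A₁ᶜ := by exact_mod_cast hA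
  have hm0 : (0 : ℝ) < m := by exact_mod_cast hm
  have : Nonempty N := ⟨(Finset.card_pos.mp hX).choose⟩
  refine card_filter_le_of_boxes (fun σ₀ x => if x ∈ A₁ then
    Finset.univ.filter fun s => best Finset.univ hm s = best Finset.univ hm (σ₀ x) else {σ₀ x})
    ?_ ?_ _ _ fun σ₀ => ?_
  · intro σ x
    split_ifs <;> simp
  · intro σ₀ σ h
    funext x
    have := h x
    split_ifs at this ⊢
    · rw [(Finset.mem_filter.mp this).2]
    · rw [Finset.mem_singleton.mp this]
  set C : N → Finset (Fin m ≃ Fin m) := fun x => if x ∈ A₁ then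
    Finset.univ.filter fun s => best Finset.univ hm s = best Finset.univ hm (σ₀ x) else {σ₀ x} with hC
  set R := leftover hm A₁ σ₀ with hR
  set F := leftoverFirst hm A₁ σ₀ with hF
  set Q := commonHits hm X X' σ₀ with hQ
  have hRA : #A₁ᶜ ≤ #R := card_compl_le_card_leftover hm hN σ₀
  have hRm : (#R : ℝ) ≤ m := by exact_mod_cast card_leftover_le hm σ₀
  have hRne : R.Nonempty := Finset.card_pos.mp (hA.trans_le hRA)
  have hR0 : (0 : ℝ) < #R := by exact_mod_cast Finset.card_pos.mpr hRne
  have htop : ∀ σ ∈ Fintype.piFinset C, ∀ x ∈ A₁,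
      best Finset.univ hm (σ x) = best Finset.univ hm (σ₀ x) := by
    intro σ hσ x hx
    have := Fintype.mem_piFinset.mp hσ x
    simp only [hC, if_pos hx, Finset.mem_filter] at this
    exact this.2
  have hRσ : ∀ σ ∈ Fintype.piFinset C, leftover hm A₁ σ = R := fun σ hσ =>
    leftover_congr hm (htop σ hσ)
  have hFσ : ∀ σ ∈ Fintype.piFinset C, leftoverFirst hm A₁ σ = F := by
    intro σ hσ
    rw [hF, leftoverFirst, leftoverFirst, hRσ σ hσ]
    refine Finset.image_congr fun x hx => ?_
    have := Fintype.mem_piFinset.mp hσ x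
    simp only [hC, if_neg (Finset.mem_compl.mp (Finset.mem_coe.mp hx)),
      Finset.mem_singleton] at this
    simp only [this, hR]
  have hQσ : ∀ σ ∈ Fintype.piFinset C, commonHits hm X X' σ = Q := by
    intro σ hσ
    ext v
    simp only [hQ, commonHits, firstHits, Finset.mem_filter, Finset.mem_univ, true_and]
    refine and_congr (exists_congr fun x => and_congr_right fun hx => ?_)
      (exists_congr fun x => and_congr_right fun hx => ?_)
    · rw [htop σ hσ x (hXA hx)]
    · rw [htop σ hσ x (hXA' hx)]
  by_cases hbig : (#X : ℝ) ^ 2 / (16 * m) < #Q ∧ (#A₁ᶜ : ℝ) / 4 < #F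
  swap
  · rw [Finset.filter_false_of_mem]
    · simp only [Finset.card_empty, Nat.cast_zero]
      positivity
    · rintro σ hσ ⟨-, h1, h2⟩
      rw [hQσ σ hσ] at h1
      rw [hFσ σ hσ] at h2
      exact hbig ⟨h1, h2⟩
  have hFR : F ⊆ R := by
    intro v hv
    obtain ⟨x, -, rfl⟩ := Finset.mem_image.mp hv
    exact best_mem hm hRne _
  have hunif : ∀ x ∈ A₁, (#{s ∈ C x | best R hm s ∈ F} : ℝ) = #F / #R * #(C x) := by
    intro x hx
    have h1 : #{s ∈ C x | best R hm s ∈ F} =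
        ∑ q ∈ F, #{s ∈ {s ∈ C x | best R hm s ∈ F} | best R hm s = q} :=
      Finset.card_eq_sum_card_fiberwise fun s hs =>
        Finset.mem_coe.mpr (Finset.mem_filter.mp hs).2
    have hp : best Finset.univ hm (σ₀ x) ∉ R := fun hc =>
      (Finset.mem_sdiff.mp hc).2 (Finset.mem_image_of_mem _ hx)
    have h2 : ∀ q ∈ F, (#{s ∈ {s ∈ C x | best R hm s ∈ F} | best R hm s = q} : ℝ)
        = #(C x) / #R := by
      intro q hq
      have h3 : {s ∈ {s ∈ C x | best R hm s ∈ F} | best R hm s = q} =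
          {s ∈ C x | best R hm s = q} := by
        rw [Finset.filter_filter]
        refine Finset.filter_congr fun s _ => ⟨fun h => h.2, fun h => ⟨h ▸ hq, h⟩⟩
      rw [h3]
      simp only [hC, if_pos hx]
      exact card_best_top_eq hm hp (hFR hq)
    rw [h1, Nat.cast_sum, Finset.sum_congr rfl h2, Finset.sum_const, nsmul_eq_mul]
    ring
  have hex : ∀ v ∈ Q, ∃ x, x ∈ X ∧ best Finset.univ hm (σ₀ x) = v := fun v hv =>
    (Finset.mem_filter.mp (Finset.mem_filter.mp hv).1).2
  have hex' : ∀ v ∈ Q, ∃ x, x ∈ X' ∧ best Finset.univ hm (σ₀ x) = v := fun v hv =>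
    (Finset.mem_filter.mp hv).2
  choose! l hlX hl using hex
  choose! l' hlX' hl' using hex'
  have hll' : ∀ u ∈ Q, ∀ v ∈ Q, l u ≠ l' v := fun u hu v hv hc =>
    Finset.disjoint_left.mp hXX' (hlX u hu) (hc ▸ hlX' v hv)
  have h := card_filter_card_le_half_le (Fintype.piFinset C) Q
    (fun v σ => ∀ x ∈ ({l v, l' v} : Finset N), best R hm (σ x) ∈ F) ((#F / #R) ^ 2)
    (#X ^ 2 * #A₁ᶜ ^ 2 / (256 * m ^ 3)) (by positivity) (by
      calc (#X : ℝ) ^ 2 * #A₁ᶜ ^ 2 / (256 * m ^ 3)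
          = #X ^ 2 / (16 * m) * (#A₁ᶜ / 4 / m) ^ 2 := by field_simp; norm_num
        _ ≤ _ := by
          have := hbig.1.le
          have := hbig.2.le
          gcongr) (by
      intro v hv
      rw [card_piFinset_filter_forall C {l v, l' v} (fun s => best R hm s ∈ F) (#F / #R)]
      · rw [Finset.card_pair (hll' v hv v hv)]
      · intro x hx
        refine hunif x ?_
        rw [Finset.mem_insert, Finset.mem_singleton] at hx
        rcases hx with rfl | rfl
        · exact hXA (hlX v hv)
        · exact hXA' (hlX' v hv)) (by
      intro u hu v hv huv
      have hluv : l u ≠ l v := fun hc => huv (by rw [← hl u hu, hc, hl v hv])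
      have hluv' : l' u ≠ l' v := fun hc => huv (by rw [← hl' u hu, hc, hl' v hv])
      have hcard : #({l u, l' u, l v, l' v} : Finset N) = 4 := by
        rw [Finset.card_insert_of_notMem, Finset.card_insert_of_notMem, Finset.card_pair]
        · exact hll' v hv v hv
        · simp [hluv', (hll' v hv u hu).symm]
        · simp [hluv, hll' u hu u hu, hll' u hu v hv]
      have h4 := card_piFinset_filter_forall C {l u, l' u, l v, l' v}
        (fun s => best R hm s ∈ F) (#F / #R) (by
          intro x hx
          refine hunif x ?_
          simp only [Finset.mem_insert, Finset.mem_singleton] at hx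
          rcases hx with rfl | rfl | rfl | rfl
          · exact hXA (hlX u hu)
          · exact hXA' (hlX' u hu)
          · exact hXA (hlX v hv)
          · exact hXA' (hlX' v hv))
      rw [hcard] at h4
      rw [← pow_mul, ← h4]
      refine le_of_eq (congrArg _ (congrArg _ (Finset.filter_congr fun σ _ => ?_)))
      simp only [Finset.mem_insert, Finset.mem_singleton, forall_eq_or_imp, forall_eq]
      tauto)
  have e2 : (4 / (#X ^ 2 * #A₁ᶜ ^ 2 / (256 * m ^ 3)) : ℝ) =
    1024 * m ^ 3 / (#X ^ 2 * #A₁ᶜ ^ 2) := by field_simp; norm_num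
  rw [e2] at h
  refine le_trans (Nat.cast_le.mpr (Finset.card_le_card fun σ hσ => ?_)) h
  rw [Finset.mem_filter] at hσ ⊢
  obtain ⟨hσ, hno, -, -⟩ := hσ
  refine ⟨hσ, ?_⟩
  rw [Finset.filter_false_of_mem]
  · simp only [Finset.card_empty, Nat.cast_zero]
    positivity
  · intro v hv hG
    have h5 := hno (l v) (hXA (hlX v hv)) (l' v) (hXA' (hlX' v hv)) (hll' v hv v hv) (by
      rw [htop σ hσ _ (hXA (hlX v hv)), htop σ hσ _ (hXA' (hlX' v hv)), hl v hv, hl' v hv])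
    rw [hRσ σ hσ, hFσ σ hσ] at h5
    exact h5 ⟨hG _ (by simp), hG _ (by simp)⟩

theorem card_noConflict_le (hN : Fintype.card N ≤ m) (hXA : X ⊆ A₁) (hXA' : X' ⊆ A₁)
    (hXX' : Disjoint X X') (hX : 0 < #X) (hcard : #X' = #X) (hA : 0 < #A₁ᶜ) :
    (#{σ : N → (Fin m ≃ Fin m) | NoConflict hm A₁ σ} : ℝ) ≤
      (8 / #X + 32 * m / #X ^ 2 + 8 / #A₁ᶜ + 1024 * m ^ 3 / (#X ^ 2 * #A₁ᶜ ^ 2)) *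
        Fintype.card (N → (Fin m ≃ Fin m)) := by
  have hXm : #X ≤ m := (Finset.card_le_univ X).trans hN
  have h1 := card_firstHits_le (N := N) hm hX hXm
  have h2 := card_commonHits_le hm hXX' hX hXm hcard
  have h3 := card_leftoverFirst_le hm hN hA
  have h4 := card_noConflict_and_le hm hN hXA hXA' hXX' hX hA
  set B₁ : Finset (N → (Fin m ≃ Fin m)) := {σ | (#(firstHits hm X σ) : ℝ) ≤ #X / 4}
  set B₂ : Finset (N → (Fin m ≃ Fin m)) := {σ | (#X : ℝ) / 4 < #(firstHits hm X σ) ∧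
      (#(commonHits hm X X' σ) : ℝ) ≤ #X ^ 2 / (16 * m)}
  set B₃ : Finset (N → (Fin m ≃ Fin m)) := {σ | (#(leftoverFirst hm A₁ σ) : ℝ) ≤ #A₁ᶜ / 4}
  set B₄ : Finset (N → (Fin m ≃ Fin m)) := {σ | NoConflict hm A₁ σ ∧
      (#X : ℝ) ^ 2 / (16 * m) < #(commonHits hm X X' σ) ∧
      (#A₁ᶜ : ℝ) / 4 < #(leftoverFirst hm A₁ σ)}
  have hsub : ({σ | NoConflict hm A₁ σ} : Finset (N → (Fin m ≃ Fin m))) ⊆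
      B₁ ∪ B₂ ∪ B₃ ∪ B₄ := by
    intro σ hσ
    simp only [B₁, B₂, B₃, B₄, Finset.mem_union, Finset.mem_filter, Finset.mem_univ,
      true_and] at hσ ⊢
    by_contra! hc
    obtain ⟨⟨⟨c1, c2⟩, c3⟩, c4⟩ := hc
    exact absurd (c4 hσ (c2 c1)) (not_le.mpr c3)
  have hu : #{σ : N → (Fin m ≃ Fin m) | NoConflict hm A₁ σ} ≤ #B₁ + #B₂ + #B₃ + #B₄ := by
    refine (Finset.card_le_card hsub).trans ((Finset.card_union_le _ _).trans ?_)
    gcongr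
    refine (Finset.card_union_le _ _).trans ?_
    gcongr
    exact Finset.card_union_le _ _
  have hu' : (#{σ : N → (Fin m ≃ Fin m) | NoConflict hm A₁ σ} : ℝ) ≤ #B₁ + #B₂ + #B₃ + #B₄ := by
    exact_mod_cast hu
  linarith

end Profile

section Bridge

variable {n k m : ℕ} {w1 w2 : ℝ} (h : n < m ∧ w2 < w1 ∧ 0 < w2) (hm : 0 < m)
  (σ : Fin n → (Fin m ≃ Fin m))

theorem instOf_bestIn (x : Fin n) {R : Finset (Fin m)} (hR : R.Nonempty) :
    (instOf n k m w1 w2 h σ).bestIn x R = best R hm (σ x) :=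
  (best_eq hm (TwoWPM.bestIn_mem _ x hR) fun _ hq =>
    (instOf n k m w1 w2 h σ).rank_bestIn_le x hq).symm

theorem instOf_f1 (x : Fin n) :
    (instOf n k m w1 w2 h σ).f1 x = best Finset.univ hm (σ x) :=
  instOf_bestIn h hm σ x ⟨⟨0, hm⟩, Finset.mem_univ _⟩

theorem instOf_compl_F1 :
    Finset.univ \ (instOf n k m w1 w2 h σ).F1 = leftover hm {x : Fin n | (x : ℕ) < k} σ := by
  unfold leftover TwoWPM.F1
  rw [funext (instOf_f1 h hm σ)]
  rfl

theorem instOf_bestIn_compl_F1 (x : Fin n) :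
    (instOf n k m w1 w2 h σ).bestIn x (Finset.univ \ (instOf n k m w1 w2 h σ).F1) =
      best (leftover hm {x : Fin n | (x : ℕ) < k} σ) hm (σ x) := by
  rw [instOf_bestIn h hm σ x (TwoWPM.compl_F1_nonempty _), instOf_compl_F1 h hm]

theorem instOf_F2 :
    (instOf n k m w1 w2 h σ).F2 = leftoverFirst hm {x : Fin n | (x : ℕ) < k} σ := by
  have h2 : (instOf n k m w1 w2 h σ).A2 = ({x : Fin n | (x : ℕ) < k} : Finset (Fin n))ᶜ := by
    ext x
    simp [instOf]
  unfold leftoverFirst TwoWPM.F2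
  rw [h2]
  exact Finset.image_congr fun x _ => instOf_bestIn_compl_F1 h hm σ x

theorem noConflict_of_hasPopular (hP : (instOf n k m w1 w2 h σ).HasPopular) :
    NoConflict hm {x : Fin n | (x : ℕ) < k} σ := by
  intro x hx x' hx' hne hf
  have h1 := hP.not_mem_F2 hx hx' hne (by rw [instOf_f1 h hm, instOf_f1 h hm, hf])
  rw [instOf_F2 h hm] at h1
  unfold TwoWPM.s1 at h1
  rwa [instOf_bestIn_compl_F1 h hm, instOf_bestIn_compl_F1 h hm] at h1

end Bridge

theorem pmProb_le {n k m : ℕ} (w1 w2 : ℝ) (hk : 2 ≤ k) (hkn : k < n) :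
    pmProb n k m w1 w2 ≤ 8 / (k / 2 : ℕ) + 32 * m / (k / 2 : ℕ) ^ 2 + 8 / (n - k : ℕ) +
      1024 * m ^ 3 / ((k / 2 : ℕ) ^ 2 * (n - k : ℕ) ^ 2) := by
  unfold pmProb
  split_ifs with h
  · have hm : 0 < m := (Nat.zero_le n).trans_lt h.1
    have hcard : ∀ a b, b ≤ n → #({x : Fin n | a ≤ (x : ℕ) ∧ (x : ℕ) < b} : Finset (Fin n)) =
        b - a := by
      intro a b hb
      rw [← Nat.card_Ico, ← Finset.card_map Fin.valEmbedding]
      congr 1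
      ext i
      simp only [Finset.mem_map, Finset.mem_filter, Finset.mem_univ, true_and,
        Fin.valEmbedding_apply, Finset.mem_Ico]
      exact ⟨fun ⟨x, hx, hi⟩ => hi ▸ hx, fun hi => ⟨⟨i, hi.2.trans_le hb⟩, hi, rfl⟩⟩
    have hX := hcard 0 (k / 2) (by omega)
    have hX' := hcard (k / 2) (k / 2 + k / 2) (by omega)
    have hA : #({x : Fin n | (x : ℕ) < k} : Finset (Fin n))ᶜ = n - k := by
      rw [← hcard k n le_rfl]
      congr 1
      ext x
      simp
    rw [Nat.sub_zero] at hX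
    rw [Nat.add_sub_cancel] at hX'
    have hbound := card_noConflict_le (X := {x : Fin n | 0 ≤ (x : ℕ) ∧ (x : ℕ) < k / 2})
      (X' := {x : Fin n | k / 2 ≤ (x : ℕ) ∧ (x : ℕ) < k / 2 + k / 2})
      (A₁ := {x : Fin n | (x : ℕ) < k}) hm
      (by rw [Fintype.card_fin]; exact h.1.le)
      (fun x hx => by simp only [Finset.mem_filter, Finset.mem_univ, true_and] at hx ⊢; omega)
      (fun x hx => by simp only [Finset.mem_filter, Finset.mem_univ, true_and] at hx ⊢; omega)
      (Finset.disjoint_left.mpr fun x hx hx' => by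
        simp only [Finset.mem_filter, Finset.mem_univ, true_and] at hx hx'; omega)
      (by omega) (by omega) (by omega)
    rw [hX, hA] at hbound
    refine div_le_of_le_mul₀ (Nat.cast_nonneg _) (by positivity) (le_trans ?_ hbound)
    exact_mod_cast Finset.card_le_card fun σ hσ => by
      simp only [Finset.mem_filter, Finset.mem_univ, true_and] at hσ ⊢
      exact noConflict_of_hasPopular h hm σ hσ
  · positivity

/-- The number of items enters the bound on the probability only through its ratio to `n ^ (4/3)`. -/
theorem bound_le {n a b m κ : ℝ} (hn : 1 ≤ n) (hκ : 0 < κ) (hm : 0 ≤ m) (ha : κ * n ≤ a)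
    (hb : κ * n ≤ b) :
    8 / a + 32 * m / a ^ 2 + 8 / b + 1024 * m ^ 3 / (a ^ 2 * b ^ 2) ≤
      16 / κ * n⁻¹ + 32 / κ ^ 2 * (m / n ^ ((4 : ℝ) / 3)) +
        1024 / κ ^ 4 * (m / n ^ ((4 : ℝ) / 3)) ^ 3 := by
  have hn0 : 0 < n := one_pos.trans_le hn
  have hκn : 0 < κ * n := mul_pos hκ hn0
  have hr : (n ^ ((4 : ℝ) / 3)) ^ 3 = n ^ 4 := by
    rw [← Real.rpow_natCast, ← Real.rpow_mul hn0.le, ← Real.rpow_natCast]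
    norm_num
  have hr2 : n ^ ((4 : ℝ) / 3) ≤ n ^ 2 := by
    rw [← Real.rpow_natCast]
    exact Real.rpow_le_rpow_of_exponent_le hn (by norm_num)
  have hr0 : 0 < n ^ ((4 : ℝ) / 3) := Real.rpow_pos_of_pos hn0 _
  have e1 : 8 / a ≤ 8 / (κ * n) := by gcongr
  have e2 : 8 / b ≤ 8 / (κ * n) := by gcongr
  have e3 : 32 * m / a ^ 2 ≤ 32 * m / (κ ^ 2 * n ^ ((4 : ℝ) / 3)) := by
    gcongr
    calc κ ^ 2 * n ^ ((4 : ℝ) / 3) ≤ κ ^ 2 * n ^ 2 := by gcongr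
      _ = (κ * n) ^ 2 := by ring
      _ ≤ a ^ 2 := by gcongr
  have e4 : 1024 * m ^ 3 / (a ^ 2 * b ^ 2) ≤ 1024 * m ^ 3 / ((κ * n) ^ 2 * (κ * n) ^ 2) := by
    gcongr
  have e5 : 1024 * m ^ 3 / ((κ * n) ^ 2 * (κ * n) ^ 2) =
      1024 / κ ^ 4 * (m / n ^ ((4 : ℝ) / 3)) ^ 3 := by
    rw [div_pow, hr]
    field_simp
  have e6 : 32 * m / (κ ^ 2 * n ^ ((4 : ℝ) / 3)) = 32 / κ ^ 2 * (m / n ^ ((4 : ℝ) / 3)) := by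
    field_simp
  have e7 : 16 / κ * n⁻¹ = 8 / (κ * n) + 8 / (κ * n) := by
    field_simp
    norm_num
  linarith

/-- **Theorem 4, lower bound.** Fix `δ ∈ (0,1)`, `c > 1` and weights
`w1 ≥ 2 w2 > 0`. If `m(n) - n ≥ m(n)/c` for all `n` and `m(n)/n^{4/3} → 0`, then the
probability that a random instance of the complete and strict 2-weighted popular
matching problem with `n` applicants (`|A1| = δn`, `|A2| = (1-δ)n`) and `m(n)` items
has a 2-weighted popular matching tends to `0` (along those `n` with `δn ∈ ℕ`). -/
theorem random_two_weighted_popular_lower_bound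
    (δ : ℝ) (hδ0 : 0 < δ) (hδ1 : δ < 1) (c : ℝ) (hc : 1 < c)
    (w1 w2 : ℝ) (hw2 : 0 < w2) (hw12 : 2 * w2 ≤ w1)
    (m : ℕ → ℕ) (hmc : ∀ n : ℕ, (m n : ℝ) / c ≤ (m n : ℝ) - (n : ℝ))
    (hlim : Filter.Tendsto (fun n : ℕ => (m n : ℝ) / (n : ℝ) ^ ((4 : ℝ) / 3))
      Filter.atTop (nhds 0)) :
    ∀ ε : ℝ, 0 < ε → ∃ N : ℕ, ∀ n : ℕ, N ≤ n → ∀ k : ℕ, (k : ℝ) = δ * n →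
      pmProb n k (m n) w1 w2 ≤ ε := by
  intro ε hε
  obtain ⟨κ, hκ, hκδ, hκ1⟩ : ∃ κ : ℝ, 0 < κ ∧ 4 * κ ≤ δ ∧ κ ≤ 1 - δ :=
    ⟨min (δ / 4) (1 - δ), lt_min (by linarith) (by linarith),
      by linarith [min_le_left (δ / 4) (1 - δ)], min_le_right _ _⟩
  have hbound : Filter.Tendsto (fun n : ℕ => 16 / κ * (n : ℝ)⁻¹ +
      32 / κ ^ 2 * ((m n : ℝ) / (n : ℝ) ^ ((4 : ℝ) / 3)) +
        1024 / κ ^ 4 * ((m n : ℝ) / (n : ℝ) ^ ((4 : ℝ) / 3)) ^ 3) Filter.atTop (nhds 0) := by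
    simpa using ((tendsto_inv_atTop_nhds_zero_nat (𝕜 := ℝ)).const_mul (16 / κ)).add
      (hlim.const_mul (32 / κ ^ 2)) |>.add ((hlim.pow 3).const_mul (1024 / κ ^ 4))
  obtain ⟨N, hN⟩ := Filter.eventually_atTop.mp ((hbound.eventually_le_const hε).and
    ((Filter.eventually_ge_atTop 1).and
      (tendsto_natCast_atTop_atTop.eventually_ge_atTop (2 / δ))))
  refine ⟨N, fun n hn k hk => ?_⟩
  obtain ⟨hle, hn1, hnδ⟩ := hN n hn
  have hn1' : (1 : ℝ) ≤ n := by exact_mod_cast hn1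
  rw [div_le_iff₀ hδ0, mul_comm, ← hk] at hnδ
  have hk2 : 2 ≤ k := by exact_mod_cast hnδ
  have hkn : k < n := by
    have : (k : ℝ) < n := by rw [hk]; nlinarith
    exact_mod_cast this
  have hhalf : (k : ℝ) ≤ 4 * (k / 2 : ℕ) := by
    have : k ≤ 4 * (k / 2) := by omega
    exact_mod_cast this
  refine (pmProb_le w1 w2 hk2 hkn).trans
    ((bound_le hn1' hκ (Nat.cast_nonneg (m n)) ?_ ?_).trans hle)
  · nlinarith
  · rw [Nat.cast_sub hkn.le, hk]
    nlinarith
end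
end

section
/- In the random fs-relation graph model with n1 = δn and n2 = (1-δ)n for a constant δ ∈ (0,1) (δn an integer) and with m - n ≥ m/c for a constant c > 1, the random variable Z = Σ_{v ∈ T} Z_v satisfies Σ_{v ∈ T} Σ_{w ∈ T_0(v)} E[Z_v·Z_w] ≤ (E[Z])² + ( 2c⁴δ²(1-δ)·n³/m⁶ + c⁴δ²·n²/m⁶ )·|T|. -/
open scoped Classical
open Finset

noncomputable section

/-- The sample space of the random fs-relation graph model with `n1` applicants of the
first category, `n2` applicants of the second category, and `m` items: an outcome
records the `f1`-, `s1`-, `f2`- and `s2`-items assigned to the applicants. -/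
abbrev FSSpace (n1 n2 m : ℕ) : Type :=
  (Fin n1 → Fin m) × (Fin n1 → Fin m) × (Fin n2 → Fin m) × (Fin n2 → Fin m)

/-- the `f1`-items of an outcome. -/
def fOne {n1 n2 m : ℕ} (ω : FSSpace n1 n2 m) : Fin n1 → Fin m := ω.1
/-- the `s1`-items of an outcome. -/
def sOne {n1 n2 m : ℕ} (ω : FSSpace n1 n2 m) : Fin n1 → Fin m := ω.2.1
/-- the `f2`-items of an outcome. -/
def fTwo {n1 n2 m : ℕ} (ω : FSSpace n1 n2 m) : Fin n2 → Fin m := ω.2.2.1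
/-- the `s2`-items of an outcome. -/
def sTwo {n1 n2 m : ℕ} (ω : FSSpace n1 n2 m) : Fin n2 → Fin m := ω.2.2.2

/-- the set `F1` of an outcome. -/
def FOne {n1 n2 m : ℕ} (ω : FSSpace n1 n2 m) : Finset (Fin m) := Finset.univ.image (fOne ω)
/-- the set `F2` of an outcome. -/
def FTwo {n1 n2 m : ℕ} (ω : FSSpace n1 n2 m) : Finset (Fin m) := Finset.univ.image (fTwo ω)

/-- an outcome is valid if each `s1`- and `f2`-item avoids `F1` and each `s2`-item
avoids `F1 ∪ F2`, as in the sequential random process. -/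
def FSValid {n1 n2 m : ℕ} (ω : FSSpace n1 n2 m) : Prop :=
  (∀ x, sOne ω x ∉ FOne ω) ∧ (∀ y, fTwo ω y ∉ FOne ω) ∧
    (∀ y, sTwo ω y ∉ FOne ω ∪ FTwo ω)

/-- the probability of a single outcome under the sequential random process:
the `f1`-items are independent and uniform on the `m` items, then the `s1`- and
`f2`-items are independent and uniform on the items outside `F1`, then the
`s2`-items are independent and uniform on the items outside `F1 ∪ F2`. -/
def fsWeight (n1 n2 m : ℕ) (ω : FSSpace n1 n2 m) : ℝ :=
  if FSValid ω then
    (1 / (m : ℝ)) ^ n1 * (1 / ((m : ℝ) - (FOne ω).card)) ^ (n1 + n2) *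
      (1 / ((m : ℝ) - ((FOne ω) ∪ (FTwo ω)).card)) ^ n2
  else 0

/-- the probability of an event in the random fs-relation graph model. -/
def fsProb (n1 n2 m : ℕ) (S : FSSpace n1 n2 m → Prop) : ℝ :=
  ∑ ω : FSSpace n1 n2 m, if S ω then fsWeight n1 n2 m ω else 0

/-- the expectation of a random variable in the random fs-relation graph model. -/
def fsExp (n1 n2 m : ℕ) (f : FSSpace n1 n2 m → ℝ) : ℝ :=
  ∑ ω : FSSpace n1 n2 m, fsWeight n1 n2 m ω * f ω

/-- the index set `T` of tuples `(x1, x2, y1, y2)` with `x1 < x2` and `y1 ≠ y2`. -/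
def Ttup (n1 n2 : ℕ) : Finset (Fin n1 × Fin n1 × Fin n2 × Fin n2) :=
  Finset.univ.filter fun v => v.1 < v.2.1 ∧ v.2.2.1 ≠ v.2.2.2

/-- the event `{Z_v = 1}`, i.e. `f1(x1) = f1(x2)`, `f2(y1) = s1(x1)`, `f2(y2) = s1(x2)`. -/
def ZEvent {n1 n2 m : ℕ} (v : Fin n1 × Fin n1 × Fin n2 × Fin n2)
    (ω : FSSpace n1 n2 m) : Prop :=
  fOne ω v.1 = fOne ω v.2.1 ∧ fTwo ω v.2.2.1 = sOne ω v.1 ∧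
    fTwo ω v.2.2.2 = sOne ω v.2.1

/-- the indicator random variable `Z_v`. -/
def Zind {n1 n2 m : ℕ} (v : Fin n1 × Fin n1 × Fin n2 × Fin n2)
    (ω : FSSpace n1 n2 m) : ℝ :=
  if ZEvent v ω then 1 else 0

/-- the random variable `Z = ∑_{v ∈ T} Z_v`. -/
def Ztotal (n1 n2 m : ℕ) (ω : FSSpace n1 n2 m) : ℝ :=
  ∑ v ∈ Ttup n1 n2, Zind v ω

/-- `T_h(v)`: the tuples `w ∈ T \ {v}` that are `h`-common to `v`,
i.e. `|{x1, x2} ∩ {x1', x2'}| = h`. -/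
def Tcommon (n1 n2 : ℕ) (h : ℕ) (v : Fin n1 × Fin n1 × Fin n2 × Fin n2) :
    Finset (Fin n1 × Fin n1 × Fin n2 × Fin n2) :=
  (Ttup n1 n2).filter fun w =>
    w ≠ v ∧ (({v.1, v.2.1} : Finset (Fin n1)) ∩ ({w.1, w.2.1} : Finset (Fin n1))).card = h

/-- the edge of applicant `a` (first or second category) joins items `p` and `q`
in the fs-relation graph of the outcome `ω`. -/
def fsJoins {n1 n2 m : ℕ} (ω : FSSpace n1 n2 m) (a : Fin n1 ⊕ Fin n2)
    (p q : Fin m) : Prop :=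
  Sum.elim (fun x => (fOne ω x = p ∧ sOne ω x = q) ∨ (fOne ω x = q ∧ sOne ω x = p))
    (fun y => (fTwo ω y = p ∧ sTwo ω y = q) ∨ (fTwo ω y = q ∧ sTwo ω y = p)) a

/-- the fs-relation graph of the outcome contains a cycle: a closed walk on `ℓ ≥ 2`
distinct vertices using `ℓ` distinct edges. -/
def fsHasCycle {n1 n2 m : ℕ} (ω : FSSpace n1 n2 m) : Prop :=
  ∃ (ℓ : ℕ) (u : ℕ → Fin m) (c : ℕ → Fin n1 ⊕ Fin n2),
    2 ≤ ℓ ∧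
    (∀ i j, i < ℓ → j < ℓ → u i = u j → i = j) ∧
    (∀ i j, i < ℓ → j < ℓ → c i = c j → i = j) ∧
    (∀ i, i < ℓ → fsJoins ω (c i) (u i) (u ((i + 1) % ℓ)))

/-- the fs-relation graph of the outcome contains a simple path with `ℓ ≥ 4`
distinct edges and `ℓ + 1` distinct vertices. -/
def fsHasLongPath {n1 n2 m : ℕ} (ω : FSSpace n1 n2 m) : Prop :=
  ∃ (ℓ : ℕ) (v : ℕ → Fin m) (e : ℕ → Fin n1 ⊕ Fin n2),
    4 ≤ ℓ ∧
    (∀ i j, i ≤ ℓ → j ≤ ℓ → v i = v j → i = j) ∧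
    (∀ i j, i < ℓ → j < ℓ → e i = e j → i = j) ∧
    (∀ i, i < ℓ → fsJoins ω (e i) (v i) (v (i + 1)))
/-- If `φ` is an eigenfunction of the operator describing how the number of missed items changes
when one more item is drawn, then the sum over all maps of `φ` at that number is explicit. -/
lemma sum_fin_fun_eigen {m : ℕ} (φ : ℝ → ℝ) (r : ℝ)
    (hφ : ∀ k : ℕ, 1 ≤ k → ((m : ℝ) - k) * φ k + k * φ (k - 1) = (m + r) * φ k)
    (j : ℕ) (hj : j ≤ m) :
    ∑ g : Fin j → Fin m, φ ((m : ℝ) - (univ.image g).card) = (m + r) ^ j * φ m := by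
  induction j with
  | zero => simp
  | succ j ih =>
    rw [← (Fin.consEquiv fun _ => Fin m).sum_comp, Fintype.sum_prod_type_right, pow_succ',
      mul_assoc, ← ih (by omega), mul_sum]
    refine sum_congr rfl fun g _ => ?_
    have himg : ∀ a, univ.image (Fin.consEquiv (fun _ => Fin m) (a, g)) =
        insert a (univ.image g) := by
      intro a
      ext b
      simp [Fin.consEquiv, Fin.exists_fin_succ, eq_comm]
    simp only [himg]
    set s := univ.image g with hs
    have hcard : s.card ≤ j := by simpa using card_image_le (s := univ) (f := g)
    rw [← sum_add_sum_compl s]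
    have h1 : ∑ a ∈ s, φ ((m : ℝ) - (insert a s).card) = s.card * φ ((m : ℝ) - s.card) := by
      rw [← nsmul_eq_mul]
      refine sum_eq_card_nsmul fun a ha => ?_
      rw [insert_eq_of_mem ha]
    have h2 : ∑ a ∈ sᶜ, φ ((m : ℝ) - (insert a s).card) =
        ((m : ℝ) - s.card) * φ ((m : ℝ) - s.card - 1) := by
      have hc : ((sᶜ).card : ℝ) = (m : ℝ) - s.card := by
        rw [card_compl, Fintype.card_fin, Nat.cast_sub (by omega)]
      rw [← hc, ← nsmul_eq_mul]
      refine sum_eq_card_nsmul fun a ha => ?_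
      rw [card_insert_of_notMem (by simpa using ha), hc]
      push_cast
      ring_nf
    have h3 := hφ (m - s.card) (by omega)
    rw [Nat.cast_sub (by omega)] at h3
    rw [h1, h2, ← h3]
    ring

lemma sum_fun_eigen {β : Type*} [Fintype β] [DecidableEq β] {m : ℕ} (φ : ℝ → ℝ) (r : ℝ)
    (hφ : ∀ k : ℕ, 1 ≤ k → ((m : ℝ) - k) * φ k + k * φ (k - 1) = (m + r) * φ k)
    (hj : Fintype.card β ≤ m) :
    ∑ g : β → Fin m, φ ((m : ℝ) - (univ.image g).card) = (m + r) ^ Fintype.card β * φ m := by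
  rw [← sum_fin_fun_eigen φ r hφ _ hj,
    ← ((Fintype.equivFin β).arrowCongr (Equiv.refl (Fin m))).sum_comp]
  refine sum_congr rfl fun g _ => ?_
  congr 4
  ext b
  simp only [mem_image, mem_univ, true_and]
  constructor
  · rintro ⟨x, rfl⟩
    exact ⟨Fintype.equivFin β x, by simp⟩
  · rintro ⟨x, rfl⟩
    exact ⟨(Fintype.equivFin β).symm x, by simp⟩

/-- Maps invariant under an idempotent `r` are the maps on the fixed points of `r`. -/
lemma sum_invariant {α I : Type*} [Fintype α] [DecidableEq α] [Fintype I] [DecidableEq I] (r : α → α)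
    [DecidablePred fun f : α → I => ∀ x, f (r x) = f x]
    (hr : ∀ x, r (r x) = r x) (h : Finset I → ℝ) :
    ∑ f : α → I with ∀ x, f (r x) = f x, h (univ.image f) =
      ∑ g : {x // r x = x} → I, h (univ.image g) := by
  refine sum_bij' (fun f _ z => f z) (fun g _ x => g ⟨r x, hr x⟩) ?_ ?_ ?_ ?_ ?_
  · simp
  · intro g _
    simp [hr]
  · intro f hf
    ext1 x
    simpa using (mem_filter.1 hf).2 x
  · intro g _
    funext z
    simp [z.2]
  · intro f hf
    congr 1
    ext b
    simp only [mem_image, mem_univ, true_and, Subtype.exists, exists_prop]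
    constructor
    · rintro ⟨x, rfl⟩
      exact ⟨r x, hr x, (mem_filter.1 hf).2 x⟩
    · rintro ⟨x, _, rfl⟩
      exact ⟨x, rfl⟩

lemma fsExp_eq_sum {n1 n2 m : ℕ} (hm : n1 + n2 < m)
    (F : (Fin n1 → Fin m) → (Fin n1 → Fin m) → (Fin n2 → Fin m) → ℝ) :
    fsExp n1 n2 m (fun ω => F (fOne ω) (sOne ω) (fTwo ω)) =
      ∑ f : Fin n1 → Fin m, (1 / (m : ℝ)) ^ n1 *
        (1 / ((m : ℝ) - (univ.image f).card)) ^ (n1 + n2) *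
        ∑ t ∈ Fintype.piFinset (fun _ : Fin n2 => (univ.image f)ᶜ),
          ∑ s ∈ Fintype.piFinset (fun _ : Fin n1 => (univ.image f)ᶜ), F f s t := by
  unfold fsExp
  rw [Fintype.sum_prod_type]
  refine sum_congr rfl fun f _ => ?_
  rw [Fintype.sum_prod_type_right, Fintype.sum_prod_type, mul_sum]
  symm
  refine sum_subset_zero_on_sdiff (subset_univ _) (fun t ht => ?_) fun t ht => ?_
  · refine sum_eq_zero fun u _ => sum_eq_zero fun s _ => ?_
    have : ¬ FSValid (f, s, t, u) := fun h => (mem_sdiff.1 ht).2 <| by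
      simpa using fun y => by simpa [fTwo, FOne, fOne] using h.2.1 y
    simp [fsWeight, this]
  rw [sum_comm, mul_sum]
  refine sum_subset_zero_on_sdiff (subset_univ _) (fun s hs => ?_) fun s hs => ?_
  · refine sum_eq_zero fun u _ => ?_
    have : ¬ FSValid (f, s, t, u) := fun h => (mem_sdiff.1 hs).2 <| by
      simpa using fun y => by simpa [sOne, FOne, fOne] using h.1 y
    simp [fsWeight, this]
  have hvalid : ∀ u, FSValid (f, s, t, u) ↔
      u ∈ Fintype.piFinset (fun _ : Fin n2 => (univ.image f ∪ univ.image t)ᶜ) := by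
    intro u
    rw [Fintype.mem_piFinset] at hs ht
    simp only [Fintype.mem_piFinset, mem_compl] at hs ht ⊢
    exact ⟨fun h => h.2.2, fun h => ⟨hs, ht, h⟩⟩
  have hcard : (univ.image f ∪ univ.image t).card < m := by
    refine lt_of_le_of_lt ((card_union_le _ _).trans (add_le_add card_image_le card_image_le)) ?_
    simpa using hm
  have hne : (m : ℝ) - (univ.image f ∪ univ.image t).card ≠ 0 := by
    rw [sub_ne_zero]
    exact_mod_cast hcard.ne'
  simp only [fsWeight, hvalid, ite_mul, zero_mul]
  rw [sum_ite_mem, univ_inter]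
  simp only [FOne, FTwo, fOne, fTwo, sOne]
  rw [sum_const, Fintype.card_piFinset_const, card_compl, Fintype.card_fin, nsmul_eq_mul,
    Nat.cast_pow, Nat.cast_sub hcard.le]
  rw [one_div ((m : ℝ) - (univ.image f ∪ univ.image t).card), inv_pow]
  field_simp

lemma fsExp_constraint {n1 n2 m : ℕ} (hm : n1 + n2 < m) (P : (Fin n1 → Fin m) → Prop)
    [DecidablePred P] (S : Finset (Fin n1)) (τ : Fin n1 → Fin n2) (Y : FSSpace n1 n2 m → ℝ)
    (hY : ∀ ω, (P (fOne ω) ∧ ∀ x ∈ S, sOne ω x = fTwo ω (τ x)) → Y ω = 1)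
    (hY' : ∀ ω, ¬ (P (fOne ω) ∧ ∀ x ∈ S, sOne ω x = fTwo ω (τ x)) → Y ω = 0) :
    fsExp n1 n2 m Y =
      (1 / (m : ℝ)) ^ n1 *
        ∑ f : Fin n1 → Fin m with P f, (1 / ((m : ℝ) - (univ.image f).card)) ^ S.card := by
  have hY_eq : Y = fun ω =>
      if P (fOne ω) ∧ ∀ x ∈ S, sOne ω x = fTwo ω (τ x) then (1 : ℝ) else 0 := by
    funext ω
    split_ifs with h
    · exact hY ω h
    · exact hY' ω h
  rw [hY_eq, fsExp_eq_sum hm fun f s t => if P f ∧ ∀ x ∈ S, s x = t (τ x) then 1 else 0, mul_sum,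
    sum_filter]
  refine sum_congr rfl fun f _ => ?_
  split_ifs with hP
  swap
  · simp [hP]
  have hcard : (univ.image f).card ≤ n1 := by simpa using card_image_le (s := univ) (f := f)
  have hc : ((univ.image f)ᶜ.card : ℝ) = (m : ℝ) - (univ.image f).card := by
    rw [card_compl, Fintype.card_fin, Nat.cast_sub (by omega)]
  have hpos : (0 : ℝ) < (univ.image f)ᶜ.card := by
    rw [card_compl, Fintype.card_fin]
    exact_mod_cast (by omega)
  have hS : S.card ≤ n1 := by simpa using card_le_univ S
  have hinner : ∀ t ∈ Fintype.piFinset (fun _ : Fin n2 => (univ.image f)ᶜ),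
      ∑ s ∈ Fintype.piFinset (fun _ : Fin n1 => (univ.image f)ᶜ),
        (if P f ∧ ∀ x ∈ S, s x = t (τ x) then (1 : ℝ) else 0) =
      ((univ.image f)ᶜ.card : ℝ) ^ (n1 - S.card) := by
    intro t ht
    rw [sum_boole]
    have : (Fintype.piFinset (fun _ : Fin n1 => (univ.image f)ᶜ)).filter
        (fun s => P f ∧ ∀ x ∈ S, s x = t (τ x)) =
        Fintype.piFinset (fun x => if x ∈ S then {t (τ x)} else (univ.image f)ᶜ) := by
      ext s
      simp only [mem_filter, Fintype.mem_piFinset] at ht ⊢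
      constructor
      · rintro ⟨h1, -, h2⟩ x
        split_ifs with hx
        · simpa using h2 x hx
        · exact h1 x
      · intro h
        refine ⟨fun x => ?_, hP, fun x hx => ?_⟩
        · have := h x
          split_ifs at this with hx
          · rw [mem_singleton.1 this]
            exact ht _
          · exact this
        · simpa [hx] using h x
    rw [this, Fintype.card_piFinset]
    simp only [apply_ite Finset.card, card_singleton, prod_ite, prod_const_one, one_mul,
      prod_const, filter_not, filter_mem_eq_inter, univ_inter]
    rw [← compl_eq_univ_sdiff, card_compl S, Fintype.card_fin]
    push_cast
    rfl
  rw [sum_congr rfl hinner, sum_const, Fintype.card_piFinset_const, nsmul_eq_mul, ← hc]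
  push_cast
  obtain ⟨d, hd⟩ := Nat.exists_eq_add_of_le hS
  have hd' : n1 - S.card = d := by omega
  have hpow : (1 / ((univ.image f)ᶜ.card : ℝ)) ^ (n1 + n2) =
      1 / ((univ.image f)ᶜ.card : ℝ) ^ (S.card + d + n2) := by
    rw [div_pow, one_pow, ← hd]
  rw [hpow, hd', div_pow _ _ S.card, one_pow, mul_assoc]
  congr 1
  generalize S.card = q
  clear hd hd'
  field_simp
  ring

lemma card_Ttup_le (n1 n2 : ℕ) : (Ttup n1 n2).card ≤ n1 ^ 2 * n2 ^ 2 := by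
  refine (card_filter_le _ _).trans (le_of_eq ?_)
  simp [Fintype.card_prod]
  ring

lemma inv_four_le {k R : ℝ} (hR : 0 < R) (hk : R ≤ k) :
    (1 / k) ^ 4 ≤ 1 / ((k + 1) * (k + 2) * (k + 3) * (k + 4)) + 10 / R ^ 5 := by
  have hk0 : 0 < k := hR.trans_le hk
  have h1 : 10 / k ^ 5 ≤ 10 / R ^ 5 := by gcongr
  refine le_trans ?_ (add_le_add_right h1 _)
  rw [div_pow, div_add_div _ _ (by positivity) (by positivity), div_le_div_iff₀ (by positivity)
    (by positivity), ← sub_nonneg]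
  ring_nf
  positivity

lemma eigen_two (m : ℝ) (k : ℕ) (hk : 1 ≤ k) :
    (m - k) * (1 / (((k : ℝ) + 1) * (k + 2))) + k * (1 / (((k : ℝ) - 1 + 1) * (k - 1 + 2))) =
      (m + 2) * (1 / (((k : ℝ) + 1) * (k + 2))) := by
  have hk' : (1 : ℝ) ≤ k := by exact_mod_cast hk
  rw [show (k : ℝ) - 1 + 1 = k by ring, show (k : ℝ) - 1 + 2 = k + 1 by ring]
  field_simp
  ring

lemma eigen_four (m : ℝ) (k : ℕ) (hk : 1 ≤ k) :
    (m - k) * (1 / (((k : ℝ) + 1) * (k + 2) * (k + 3) * (k + 4))) +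
      k * (1 / (((k : ℝ) - 1 + 1) * (k - 1 + 2) * (k - 1 + 3) * (k - 1 + 4))) =
      (m + 4) * (1 / (((k : ℝ) + 1) * (k + 2) * (k + 3) * (k + 4))) := by
  have hk' : (1 : ℝ) ≤ k := by exact_mod_cast hk
  rw [show (k : ℝ) - 1 + 1 = k by ring, show (k : ℝ) - 1 + 2 = k + 1 by ring,
    show (k : ℝ) - 1 + 3 = k + 2 by ring, show (k : ℝ) - 1 + 4 = k + 3 by ring]
  field_simp
  ring

/-- A lower bound for `E[Z_v]`. -/
def zLower (n1 m : ℕ) : ℝ :=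
  (1 / (m : ℝ)) ^ n1 * ((m + 2 : ℝ) ^ (n1 - 1) * (1 / (((m : ℝ) + 1) * (m + 2))))

lemma zLower_le_fsExp {n1 n2 m : ℕ} (hm : n1 + n2 < m)
    {v : Fin n1 × Fin n1 × Fin n2 × Fin n2} (hv : v ∈ Ttup n1 n2) :
    zLower n1 m ≤ fsExp n1 n2 m (Zind v) := by
  obtain ⟨x1, x2, y1, y2⟩ := v
  obtain ⟨hx, -⟩ : x1 < x2 ∧ y1 ≠ y2 := by simpa [Ttup] using hv
  set r : Fin n1 → Fin n1 := fun x => if x = x2 then x1 else x with hr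
  have hZ : ∀ ω : FSSpace n1 n2 m, ZEvent (x1, x2, y1, y2) ω ↔
      (∀ x, fOne ω (r x) = fOne ω x) ∧ ∀ x ∈ ({x1, x2} : Finset (Fin n1)),
        sOne ω x = fTwo ω (if x = x1 then y1 else y2) := by
    intro ω
    simp only [ZEvent, hr, mem_insert, mem_singleton, forall_eq_or_imp, forall_eq, if_true,
      if_neg hx.ne', eq_comm (a := sOne ω _)]
    refine and_congr_left fun _ => ⟨fun h x => ?_, fun h => ?_⟩
    · split_ifs with hxx
      · rw [hxx, h]
      · rfl
    · simpa using h x2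
  rw [fsExp_constraint hm (fun f => ∀ x, f (r x) = f x) {x1, x2}
    (fun x => if x = x1 then y1 else y2) (Zind (x1, x2, y1, y2)) (fun ω h => if_pos ((hZ ω).2 h))
    (fun ω h => if_neg fun h' => h ((hZ ω).1 h')), card_pair hx.ne, zLower]
  have hrr : ∀ x, r (r x) = r x := by
    intro x
    simp only [hr]
    split_ifs <;> simp_all
  have hcard : Fintype.card {x // r x = x} = n1 - 1 := by
    have : ∀ x, r x = x ↔ ¬ x = x2 := by
      intro x
      simp only [hr]
      split_ifs with h
      · simp [h, hx.ne]
      · simp [h]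
    simp [this, Fintype.card_subtype_compl]
  have key := sum_fun_eigen (β := {x // r x = x}) (m := m)
    (fun k => 1 / ((k + 1) * (k + 2))) 2 (fun k hk => eigen_two m k hk) (by omega)
  rw [hcard] at key
  rw [← key, ← sum_invariant r hrr (fun s => 1 / (((m : ℝ) - s.card + 1) * ((m : ℝ) - s.card + 2)))]
  gcongr with f hf
  have hcard : (univ.image f).card ≤ n1 := by simpa using card_image_le (s := univ) (f := f)
  have hpos : (0 : ℝ) < (m : ℝ) - (univ.image f).card := by
    rw [sub_pos]
    exact_mod_cast (by omega)
  rw [div_pow, one_pow]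
  gcongr
  nlinarith

lemma fsExp_mul_le {n1 n2 m : ℕ} (hm : n1 + n2 < m)
    {v w : Fin n1 × Fin n1 × Fin n2 × Fin n2} (hv : v ∈ Ttup n1 n2)
    (hw : w ∈ Tcommon n1 n2 0 v) :
    fsExp n1 n2 m (fun ω => Zind v ω * Zind w ω) ≤
      zLower n1 m ^ 2 + 10 / ((m : ℝ) ^ 2 * ((m : ℝ) - n1) ^ 5) := by
  obtain ⟨x1, x2, y1, y2⟩ := v
  obtain ⟨x3, x4, y3, y4⟩ := w
  obtain ⟨h12, -⟩ : x1 < x2 ∧ y1 ≠ y2 := by simpa [Ttup] using hv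
  simp only [Tcommon, Ttup, mem_filter, mem_univ, true_and, card_eq_zero] at hw
  obtain ⟨⟨h34, -⟩, -, hdisj⟩ := hw
  replace h12 := h12.ne
  replace h34 := h34.ne
  rw [← disjoint_iff_inter_eq_empty] at hdisj
  simp only [disjoint_insert_left, disjoint_singleton_left, mem_insert, mem_singleton,
    not_or] at hdisj
  obtain ⟨⟨h13, h14⟩, h23, h24⟩ := hdisj
  set r : Fin n1 → Fin n1 := fun x => if x = x2 then x1 else if x = x4 then x3 else x with hr
  set τ : Fin n1 → Fin n2 := fun x =>
    if x = x1 then y1 else if x = x2 then y2 else if x = x3 then y3 else y4 with hτ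
  have hZ : ∀ ω : FSSpace n1 n2 m,
      ZEvent (x1, x2, y1, y2) ω ∧ ZEvent (x3, x4, y3, y4) ω ↔
      (∀ x, fOne ω (r x) = fOne ω x) ∧ ∀ x ∈ ({x1, x2, x3, x4} : Finset (Fin n1)),
        sOne ω x = fTwo ω (τ x) := by
    intro ω
    have hr' : (∀ x, fOne ω (r x) = fOne ω x) ↔
        fOne ω x1 = fOne ω x2 ∧ fOne ω x3 = fOne ω x4 := by
      refine ⟨fun h => ⟨by simpa [hr] using h x2, by simpa [hr, Ne.symm h24] using h x4⟩, ?_⟩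
      rintro ⟨h1, h2⟩ x
      simp only [hr]
      split_ifs with ha hb
      · rw [ha, h1]
      · rw [hb, h2]
      · rfl
    rw [hr']
    simp only [ZEvent, hτ, mem_insert, mem_singleton, forall_eq_or_imp, forall_eq, if_true,
      if_neg h12.symm, if_neg (Ne.symm h13), if_neg (Ne.symm h23), if_neg (Ne.symm h14),
      if_neg (Ne.symm h24), if_neg h34.symm, eq_comm (a := sOne ω _)]
    tauto
  have h4 : ({x1, x2, x3, x4} : Finset (Fin n1)).card = 4 := by
    rw [card_insert_of_notMem (by simp [*]), card_insert_of_notMem (by simp [*]), card_pair h34]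
  have hmul : ∀ ω : FSSpace n1 n2 m,
      Zind (x1, x2, y1, y2) ω * Zind (x3, x4, y3, y4) ω =
        if ZEvent (x1, x2, y1, y2) ω ∧ ZEvent (x3, x4, y3, y4) ω then 1 else 0 := by
    intro ω
    simp only [Zind, mul_ite, mul_one, mul_zero, ← ite_and, and_comm]
  rw [fsExp_constraint hm (fun f => ∀ x, f (r x) = f x) {x1, x2, x3, x4} τ _
    (fun ω h => (hmul ω).trans (if_pos ((hZ ω).2 h)))
    (fun ω h => (hmul ω).trans (if_neg fun h' => h ((hZ ω).1 h'))), h4]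
  have hrr : ∀ x, r (r x) = r x := by
    intro x
    simp only [hr]
    split_ifs <;> simp_all
  have hn1 : 4 ≤ n1 := by
    have := card_le_univ ({x1, x2, x3, x4} : Finset (Fin n1))
    simpa [h4] using this
  have hcard : Fintype.card {x // r x = x} = n1 - 2 := by
    have : ∀ x, r x = x ↔ ¬ (x ∈ ({x2, x4} : Finset (Fin n1))) := by
      intro x
      simp only [hr, mem_insert, mem_singleton]
      split_ifs with h h'
      · simp [h, h12]
      · simp [h', h34]
      · simp [h, h']
    simp only [this]
    rw [Fintype.card_subtype_compl, Fintype.card_fin, Fintype.card_coe, card_pair h24]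
  obtain ⟨N, rfl⟩ : ∃ N, n1 = N + 2 := ⟨n1 - 2, by omega⟩
  have key := sum_fun_eigen (β := {x // r x = x}) (m := m)
    (fun k => 1 / ((k + 1) * (k + 2) * (k + 3) * (k + 4))) 4 (fun k hk => eigen_four m k hk)
    (by omega)
  rw [hcard, Nat.add_sub_cancel] at key
  have hm0 : (0 : ℝ) < m := by exact_mod_cast (by omega)
  have hmn : (0 : ℝ) < (m : ℝ) - (N + 2 : ℕ) := by
    rw [sub_pos]
    exact_mod_cast (by omega)
  rw [sum_invariant r hrr (fun s => (1 / ((m : ℝ) - s.card)) ^ 4)]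
  have hbound : ∑ g : {x // r x = x} → Fin m, (1 / ((m : ℝ) - (univ.image g).card)) ^ 4 ≤
      (m + 4) ^ N * (1 / (((m : ℝ) + 1) * (m + 2) * (m + 3) * (m + 4))) +
        (m : ℝ) ^ N * (10 / ((m : ℝ) - (N + 2 : ℕ)) ^ 5) := by
    rw [← key]
    have hconst : (m : ℝ) ^ N * (10 / ((m : ℝ) - (N + 2 : ℕ)) ^ 5) =
        ∑ g : {x // r x = x} → Fin m, 10 / ((m : ℝ) - (N + 2 : ℕ)) ^ 5 := by
      rw [sum_const, card_univ, Fintype.card_fun, hcard, nsmul_eq_mul]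
      simp
    rw [hconst, ← sum_add_distrib]
    refine sum_le_sum fun g _ => inv_four_le hmn ?_
    have : (univ.image g).card ≤ N + 2 := by
      have := card_image_le (s := univ) (f := g)
      rw [card_univ, hcard] at this
      omega
    have : ((univ.image g).card : ℝ) ≤ (N + 2 : ℕ) := by exact_mod_cast this
    linarith
  refine (mul_le_mul_of_nonneg_left hbound (by positivity)).trans ?_
  rw [mul_add]
  refine add_le_add ?_ (le_of_eq ?_)
  · rw [zLower, show N + 2 - 1 = N + 1 by omega]
    have h1 : ((m : ℝ) * (m + 4)) ^ N ≤ ((m + 2) ^ 2) ^ N := by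
      gcongr
      nlinarith
    have h2 : 1 / (((m : ℝ) + 1) * (m + 2) * (m + 3) * (m + 4)) ≤
        (1 / (((m : ℝ) + 1) * (m + 2))) ^ 2 := by
      rw [div_pow, one_pow]
      gcongr
      rw [sq, mul_assoc _ ((m : ℝ) + 3)]
      gcongr <;> linarith
    have h3 : (m : ℝ) ^ 2 ≤ (m + 2) ^ 2 := by gcongr; linarith
    calc (1 / (m : ℝ)) ^ (N + 2) *
          ((m + 4) ^ N * (1 / (((m : ℝ) + 1) * (m + 2) * (m + 3) * (m + 4))))
        = ((1 / (m : ℝ)) ^ (N + 2)) ^ 2 * (((m : ℝ) * (m + 4)) ^ N * (m : ℝ) ^ 2 *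
          (1 / (((m : ℝ) + 1) * (m + 2) * (m + 3) * (m + 4)))) := by
          rw [mul_pow, one_div, inv_pow]
          field_simp
          ring
      _ ≤ ((1 / (m : ℝ)) ^ (N + 2)) ^ 2 * (((m + 2) ^ 2) ^ N * (m + 2) ^ 2 *
          (1 / (((m : ℝ) + 1) * (m + 2))) ^ 2) := by gcongr
      _ = _ := by rw [← pow_mul ((m : ℝ) + 2) 2 N]; ring
  · rw [one_div, inv_pow]
    field_simp
    ring

lemma fsExp_Ztotal (n1 n2 m : ℕ) :
    fsExp n1 n2 m (Ztotal n1 n2 m) = ∑ v ∈ Ttup n1 n2, fsExp n1 n2 m (Zind v) := by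
  simp only [fsExp, Ztotal, mul_sum]
  exact sum_comm

/-- **Inequality (8).** In the random fs-relation graph model with
`n1 = δn`, `n2 = (1-δ)n` and `m - n ≥ m/c`, the sum over `v ∈ T` and `w ∈ T_0(v)` of
`E[Z_v Z_w]` is at most `E[Z]² + (2c⁴δ²(1-δ)n³/m⁶ + c⁴δ²n²/m⁶)·|T|`. -/
theorem zero_common_sum_bound (δ : ℝ) (hδ0 : 0 < δ) (hδ1 : δ < 1)
    (c : ℝ) (hc : 1 < c) (n n1 n2 m : ℕ)
    (hn1 : (n1 : ℝ) = δ * n) (hn2 : (n2 : ℝ) = (1 - δ) * n)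
    (hm : n < m) (hmc : (m : ℝ) / c ≤ (m : ℝ) - (n : ℝ)) :
    ∑ v ∈ Ttup n1 n2, ∑ w ∈ Tcommon n1 n2 0 v,
        fsExp n1 n2 m (fun ω => Zind v ω * Zind w ω) ≤
      fsExp n1 n2 m (Ztotal n1 n2 m) ^ 2 +
        (2 * c ^ 4 * δ ^ 2 * (1 - δ) * (n : ℝ) ^ 3 / (m : ℝ) ^ 6 +
          c ^ 4 * δ ^ 2 * (n : ℝ) ^ 2 / (m : ℝ) ^ 6) * ((Ttup n1 n2).card : ℝ) := by
  have hsum : n1 + n2 = n := by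
    have : (n1 : ℝ) + n2 = n := by rw [hn1, hn2]; ring
    exact_mod_cast this
  have hlt : n1 + n2 < m := by omega
  have hm0 : (0 : ℝ) < m := by exact_mod_cast (by omega)
  have hc0 : 0 < c := by linarith
  set t : ℝ := ((Ttup n1 n2).card : ℝ) with ht
  have ht0 : 0 ≤ t := by positivity
  have htle : t ≤ (n1 : ℝ) ^ 2 * (n2 : ℝ) ^ 2 := by
    rw [ht]
    exact_mod_cast card_Ttup_le n1 n2
  set D : ℝ := (m : ℝ) - n with hD
  have hD0 : 0 < D := by
    rw [hD, sub_pos]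
    exact_mod_cast hm
  have hR : (m : ℝ) - n1 = D + n2 := by
    rw [hD, ← hsum]
    push_cast
    ring
  have hb0 : 0 ≤ zLower n1 m := by
    unfold zLower
    positivity
  have hEZ : t * zLower n1 m ≤ fsExp n1 n2 m (Ztotal n1 n2 m) := by
    rw [fsExp_Ztotal, ht, ← nsmul_eq_mul]
    exact card_nsmul_le_sum _ _ _ fun v hv => zLower_le_fsExp hlt hv
  set e : ℝ := 10 / ((m : ℝ) ^ 2 * ((m : ℝ) - n1) ^ 5) with he
  have he0 : 0 ≤ e := by
    rw [he, hR]
    positivity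
  have hL : ∑ v ∈ Ttup n1 n2, ∑ w ∈ Tcommon n1 n2 0 v,
      fsExp n1 n2 m (fun ω => Zind v ω * Zind w ω) ≤ t * (t * (zLower n1 m ^ 2 + e)) := by
    rw [ht, ← nsmul_eq_mul]
    refine sum_le_card_nsmul _ _ _ fun v hv => ?_
    refine (sum_le_card_nsmul _ _ _ fun w hw => fsExp_mul_le hlt hv hw).trans ?_
    rw [nsmul_eq_mul]
    have hcard : (Tcommon n1 n2 0 v).card ≤ (Ttup n1 n2).card := card_filter_le _ _
    gcongr
  have hsq : (t * zLower n1 m) ^ 2 ≤ fsExp n1 n2 m (Ztotal n1 n2 m) ^ 2 := by gcongr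
  have hcD : 1 / D ≤ c / m := by
    rw [div_le_div_iff₀ hD0 hm0]
    rw [div_le_iff₀ hc0] at hmc
    linarith
  have hcD4 : 1 / D ^ 4 ≤ c ^ 4 / (m : ℝ) ^ 4 := by
    have : (1 / D) ^ 4 ≤ (c / m) ^ 4 := by gcongr
    simpa [div_pow] using this
  have hn2D : 5 * (n2 * D ^ 4) ≤ (D + n2) ^ 5 := by
    rw [← sub_nonneg]
    ring_nf
    positivity
  have hte : t * e ≤ 2 * c ^ 4 * δ ^ 2 * (1 - δ) * (n : ℝ) ^ 3 / (m : ℝ) ^ 6 := by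
    calc t * e ≤ (n1 : ℝ) ^ 2 * (n2 : ℝ) ^ 2 * e := by gcongr
      _ = 2 * (n1 : ℝ) ^ 2 * n2 / (m : ℝ) ^ 2 * (5 * n2 / (D + n2) ^ 5) := by
        rw [he, hR]
        field_simp
        ring
      _ ≤ 2 * (n1 : ℝ) ^ 2 * n2 / (m : ℝ) ^ 2 * (1 / D ^ 4) := by
        refine mul_le_mul_of_nonneg_left ?_ (by positivity)
        rw [div_le_div_iff₀ (by positivity) (by positivity)]
        linarith
      _ ≤ 2 * (n1 : ℝ) ^ 2 * n2 / (m : ℝ) ^ 2 * (c ^ 4 / (m : ℝ) ^ 4) := by gcongr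
      _ = 2 * c ^ 4 * δ ^ 2 * (1 - δ) * (n : ℝ) ^ 3 / (m : ℝ) ^ 6 := by
        rw [hn1, hn2]
        field_simp
  have hrest : 0 ≤ c ^ 4 * δ ^ 2 * (n : ℝ) ^ 2 / (m : ℝ) ^ 6 := by positivity
  nlinarith [mul_le_mul_of_nonneg_right hte ht0, mul_nonneg hrest ht0]
end
end
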